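/- arXiv:1606.06412 — 2 statements merged into one kernel-verified Lean document; each statement's English description precedes it below -/
import Mathlib

section
/- Let g ≥ 3, b ≥ 3 and k ≥ 1 be integers, and let G be a connected finite simple graph with exactly g blocks, each of which is a cycle of length b, such that the block-cut vertex tree of G is a path and every pair of distinct cut vertices of G that lie in a common block are at distance exactly k from each other in G. Then gon(G) = min( ⌊(g + 3)/2⌋, min{ t ∈ {1,…,b} : t·k ≡ 0 (mod b) } ). -/
open SimpleGraph Finset
open scoped Classical

noncomputable section

def lap {V : Type} [Fintype V] (G : SimpleGraph V) (S : V → ℤ) : V → ℤ :=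
  fun v => ∑ w : V, if G.Adj v w then S v - S w else 0

def Effective {V : Type} (D : V → ℤ) : Prop := ∀ v, 0 ≤ D v

def degDiv {V : Type} [Fintype V] (D : V → ℤ) : ℤ := ∑ v, D v

def LinEquiv {V : Type} [Fintype V] (G : SimpleGraph V) (D D' : V → ℤ) : Prop :=
  ∃ S : V → ℤ, D' = D - lap G S

def PosRank {V : Type} [Fintype V] (G : SimpleGraph V) (D : V → ℤ) : Prop :=
  ∀ v : V, ∃ D' : V → ℤ, Effective D' ∧ LinEquiv G D D' ∧ 1 ≤ D' v

def gonality {V : Type} [Fintype V] (G : SimpleGraph V) : ℕ :=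
  sInf {n : ℕ | ∃ D : V → ℤ, Effective D ∧ PosRank G D ∧ degDiv D = (n : ℤ)}

def indic {V : Type} (A : Set V) : V → ℤ := fun v => if v ∈ A then 1 else 0

/-- `G` is `k`-connected: more than `k` vertices, and removing fewer than `k`
vertices leaves a connected graph. -/
def KConnected {V : Type} [Fintype V] (G : SimpleGraph V) (k : ℕ) : Prop :=
  k < Fintype.card V ∧ ∀ S : Finset V, S.card < k → (G.induce ((↑S : Set V)ᶜ)).Connected

/-- The cycle graph on `ℤ/b`: `x` is adjacent to `y` iff `x - y ∈ {1, -1}`. -/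
def zmodCycle (b : ℕ) : SimpleGraph (ZMod b) :=
  SimpleGraph.fromRel (fun x y => x - y = 1)

/-- `v` is a cut vertex of `G`: `G - v` is disconnected. -/
def IsCutVertex {V : Type} [Fintype V] (G : SimpleGraph V) (v : V) : Prop :=
  ¬ (G.induce (({v} : Set V)ᶜ)).Connected

/-- A subgraph `B` of `G` is a block if no 2-connected subgraph of `G` properly
contains it, and `B` is 2-connected or isomorphic to `K₂`. -/
def IsBlock {V : Type} [Fintype V] (G : SimpleGraph V) (B : G.Subgraph) : Prop :=
  (¬ ∃ B' : G.Subgraph, KConnected B'.coe 2 ∧ B < B') ∧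
  (KConnected B.coe 2 ∨ ∃ u v : V, u ≠ v ∧ B.verts = {u, v} ∧ B.Adj u v)

/-- The block-cut vertex tree of `G`: the bipartite graph on cut vertices and
blocks, with a cut vertex `v` adjacent to a block `B` exactly when `v ∈ V(B)`. -/
def blockCutTree {V : Type} [Fintype V] (G : SimpleGraph V) :
    SimpleGraph ({v : V // IsCutVertex G v} ⊕ {B : G.Subgraph // IsBlock G B}) :=
  SimpleGraph.fromRel (fun x y =>
    ∃ (v : {v : V // IsCutVertex G v}) (B : {B : G.Subgraph // IsBlock G B}),
      x = Sum.inl v ∧ y = Sum.inr B ∧ v.val ∈ B.val.verts)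

/-- `G` is a chain of `g` cycles of length `b`: the `i`-th cycle is parametrised by `c i`, and the
point `z i` of the `i`-th cycle is glued to the point `a (i + 1)` of the next one. -/
structure IsCycleChain {V : Type} (G : SimpleGraph V) (g b : ℕ) (c : ℕ → ZMod b → V)
    (a z : ℕ → ZMod b) : Prop where
  inj : ∀ i < g, Function.Injective (c i)
  glue : ∀ i, i + 1 < g → c i (z i) = c (i + 1) (a (i + 1))
  meet : ∀ i j x y, i < j → j < g → c i x = c j y → j = i + 1 ∧ x = z i ∧ y = a j
  cover : ∀ v, ∃ i < g, ∃ x, c i x = v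
  adj : ∀ v w, G.Adj v w ↔
    ∃ i < g, ∃ x y, c i x = v ∧ c i y = w ∧ (x - y = 1 ∨ y - x = 1)

/-- `p i` retracts a chain of cycles onto its `i`-th cycle. -/
structure IsRetraction {V : Type} (g b : ℕ) (c : ℕ → ZMod b → V) (a z : ℕ → ZMod b)
    (p : ℕ → V → ZMod b) : Prop where
  same : ∀ i < g, ∀ x, p i (c i x) = x
  left : ∀ i j x, j < i → i < g → p i (c j x) = a i
  right : ∀ i j x, i < j → j < g → p i (c j x) = z i

section Chain

variable {V : Type} {G : SimpleGraph V} {g b : ℕ} {c : ℕ → ZMod b → V}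
  {a z : ℕ → ZMod b} {p : ℕ → V → ZMod b}

theorem IsCycleChain.exists_isRetraction (h : IsCycleChain G g b c a z) :
    ∃ p, IsRetraction g b c a z p := by
  classical
  refine ⟨fun i v => if hv : ∃ x, c i x = v then hv.choose else
    if ∃ j < i, ∃ x, c j x = v then a i else z i, ?_, ?_, ?_⟩
  · intro i hi x
    have hv : ∃ y, c i y = c i x := ⟨x, rfl⟩
    simp only [dif_pos hv]
    exact h.inj i hi hv.choose_spec
  · intro i j x hj hi
    by_cases hv : ∃ y, c i y = c j x
    · simp only [dif_pos hv]
      exact (h.meet j i x _ hj hi hv.choose_spec.symm).2.2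
    · simp only [dif_neg hv]
      rw [if_pos ⟨j, hj, x, rfl⟩]
  · intro i j x hj hi
    by_cases hv : ∃ y, c i y = c j x
    · simp only [dif_pos hv]
      exact (h.meet i j _ x hj hi hv.choose_spec).2.1
    · simp only [dif_neg hv]
      rw [if_neg]
      rintro ⟨l, hl, y, hy⟩
      have := (h.meet l j y x (by omega) hi hy).1
      omega

theorem IsCycleChain.adj_retraction (h : IsCycleChain G g b c a z) (hp : IsRetraction g b c a z p)
    {i : ℕ} (hi : i < g) {v w : V} (hvw : G.Adj v w) :
    p i v = p i w ∨ ∃ x y, c i x = v ∧ c i y = w ∧ (x - y = 1 ∨ y - x = 1) := by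
  obtain ⟨j, hj, x, y, rfl, rfl, hxy⟩ := (h.adj v w).1 hvw
  rcases lt_trichotomy i j with hij | rfl | hij
  · left
    rw [hp.right i j x hij hj, hp.right i j y hij hj]
  · exact Or.inr ⟨x, y, rfl, rfl, hxy⟩
  · left
    rw [hp.left i j x hij hi, hp.left i j y hij hi]

theorem sum_adj_retraction [Fintype V] {M : Type*} [AddCommGroup M]
    (h : IsCycleChain G g b c a z) (hp : IsRetraction g b c a z p) (hb : 3 ≤ b)
    {i : ℕ} (hi : i < g) (f : ZMod b → M) (x : ZMod b) :
    (∑ w, if G.Adj (c i x) w then f (p i (c i x)) - f (p i w) else 0) =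
      (f x - f (x + 1)) + (f x - f (x - 1)) := by
  have h2 : (x + 1 : ZMod b) ≠ x - 1 := by
    intro h'
    have : ((2 : ℕ) : ZMod b) = 0 := by
      push_cast
      linear_combination h'
    rw [ZMod.natCast_eq_zero_iff] at this
    exact absurd (Nat.le_of_dvd (by norm_num) this) (by omega)
  rw [Fintype.sum_eq_add (c i (x + 1)) (c i (x - 1)) (fun h' => h2 (h.inj i hi h'))]
  · rw [if_pos, if_pos, hp.same i hi, hp.same i hi, hp.same i hi]
    · exact (h.adj _ _).2 ⟨i, hi, x, x - 1, rfl, rfl, Or.inl (by ring)⟩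
    · exact (h.adj _ _).2 ⟨i, hi, x, x + 1, rfl, rfl, Or.inr (by ring)⟩
  · rintro w ⟨h3, h4⟩
    split_ifs with hw
    · rcases h.adj_retraction hp hi hw with h5 | ⟨x', y, hx, rfl, h5⟩
      · rw [h5, sub_self]
      · obtain rfl := h.inj i hi hx
        rcases h5 with h5 | h5
        · exact absurd (congrArg (c i) (by linear_combination -h5)) h4
        · exact absurd (congrArg (c i) (by linear_combination h5)) h3
    · rfl

theorem sum_adj_retraction_of_notMem [Fintype V] {M : Type*} [AddCommGroup M]
    (h : IsCycleChain G g b c a z) (hp : IsRetraction g b c a z p)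
    {i : ℕ} (hi : i < g) (f : ZMod b → M) {v : V} (hv : ∀ x, c i x ≠ v) :
    (∑ w, if G.Adj v w then f (p i v) - f (p i w) else 0) = 0 := by
  refine Finset.sum_eq_zero fun w _ => ?_
  split_ifs with hw
  · rcases h.adj_retraction hp hi hw with h5 | ⟨x', y, hx, rfl, h5⟩
    · rw [h5, sub_self]
    · exact absurd hx (hv x')
  · rfl

end Chain

section Laplacian

variable {V : Type} [Fintype V] (G : SimpleGraph V)

theorem sum_lap_mul {R : Type*} [CommRing R] (S : V → ℤ) (h : V → R) :
    ∑ v, (lap G S v : R) * h v = ∑ v, (S v : R) * ∑ w, if G.Adj v w then h v - h w else 0 := by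
  have e1 : ∀ v, (lap G S v : R) * h v =
      (∑ w, if G.Adj v w then (S v : R) * h v else 0) -
        ∑ w, if G.Adj v w then (S w : R) * h v else 0 := by
    intro v
    rw [lap, ← Finset.sum_sub_distrib, Int.cast_sum, Finset.sum_mul]
    refine Finset.sum_congr rfl fun w _ => ?_
    split_ifs
    · push_cast
      ring
    · simp
  have e2 : ∀ v, (S v : R) * (∑ w, if G.Adj v w then h v - h w else 0) =
      (∑ w, if G.Adj v w then (S v : R) * h v else 0) -
        ∑ w, if G.Adj v w then (S v : R) * h w else 0 := by
    intro v
    rw [Finset.mul_sum, ← Finset.sum_sub_distrib]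
    refine Finset.sum_congr rfl fun w _ => ?_
    split_ifs
    · ring
    · simp
  simp_rw [e1, e2]
  rw [Finset.sum_sub_distrib, Finset.sum_sub_distrib]
  congr 1
  rw [Finset.sum_comm]
  simp_rw [G.adj_comm]

theorem LinEquiv.degDiv_eq {G : SimpleGraph V} {D D' : V → ℤ} (h : LinEquiv G D D') :
    degDiv D' = degDiv D := by
  obtain ⟨S, rfl⟩ := h
  have := sum_lap_mul G S (fun _ => (1 : ℤ))
  simp at this
  simp [degDiv, this]

theorem LinEquiv.sum_mul_retraction {G : SimpleGraph V} {g b : ℕ} {c : ℕ → ZMod b → V}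
    {a z : ℕ → ZMod b} {p : ℕ → V → ZMod b} (h : IsCycleChain G g b c a z)
    (hp : IsRetraction g b c a z p) (hb : 3 ≤ b) {D D' : V → ℤ} (hD : LinEquiv G D D')
    {i : ℕ} (hi : i < g) :
    ∑ v, (D' v : ZMod b) * p i v = ∑ v, (D v : ZMod b) * p i v := by
  obtain ⟨S, rfl⟩ := hD
  have h0 : ∑ v, (lap G S v : ZMod b) * p i v = 0 := by
    rw [sum_lap_mul]
    refine Finset.sum_eq_zero fun v _ => ?_
    by_cases hv : ∃ x, c i x = v
    · obtain ⟨x, rfl⟩ := hv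
      have := sum_adj_retraction h hp hb hi (fun y => y) x
      rw [this]
      ring
    · push Not at hv
      have := sum_adj_retraction_of_notMem h hp hi (fun y => y) hv
      rw [this, mul_zero]
  simp [sub_mul, Finset.sum_sub_distrib, h0]

/-- The Laplacian as an additive homomorphism. -/
def lapHom : (V → ℤ) →+ (V → ℤ) where
  toFun := lap G
  map_zero' := by
    ext v
    simp [lap]
  map_add' S T := by
    ext v
    simp only [lap, Pi.add_apply, ← Finset.sum_add_distrib]
    refine Finset.sum_congr rfl fun w _ => ?_
    split_ifs
    · ring
    · simp

/-- The class of a divisor modulo linear equivalence. -/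
def divClass : (V → ℤ) →+ (V → ℤ) ⧸ (lapHom G).range :=
  QuotientAddGroup.mk' _

theorem linEquiv_of_divClass_eq {D D' : V → ℤ} (h : divClass G D = divClass G D') :
    LinEquiv G D D' := by
  obtain ⟨S, hS⟩ := QuotientAddGroup.eq.1 h
  refine ⟨-S, ?_⟩
  have : lap G (-S) = - lap G S := map_neg (lapHom G) S
  rw [this]
  have hS' : lap G S = -D + D' := hS
  rw [hS']
  abel

theorem divClass_lap (S : V → ℤ) : divClass G (lap G S) = 0 :=
  (QuotientAddGroup.eq_zero_iff _).2 ⟨S, rfl⟩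

/-- The divisor class of a single vertex. -/
def pt (v : V) : (V → ℤ) ⧸ (lapHom G).range := divClass G (Pi.single v 1)

/-- A divisor class is effective if it contains an effective divisor. -/
def EffClass (α : (V → ℤ) ⧸ (lapHom G).range) : Prop :=
  ∃ D : V → ℤ, Effective D ∧ divClass G D = α

variable {G}

theorem EffClass.zero : EffClass G 0 := ⟨0, fun _ => le_rfl, map_zero _⟩

theorem EffClass.pt (v : V) : EffClass G (pt G v) :=
  ⟨Pi.single v 1, fun w => by by_cases h : w = v <;> simp [h], rfl⟩

theorem EffClass.add {α β : (V → ℤ) ⧸ (lapHom G).range} (hα : EffClass G α)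
    (hβ : EffClass G β) : EffClass G (α + β) := by
  obtain ⟨D, hD, rfl⟩ := hα
  obtain ⟨E, hE, rfl⟩ := hβ
  exact ⟨D + E, fun v => add_nonneg (hD v) (hE v), map_add _ _ _⟩

theorem EffClass.nsmul {α : (V → ℤ) ⧸ (lapHom G).range} (hα : EffClass G α) (n : ℕ) :
    EffClass G (n • α) := by
  induction n with
  | zero => simpa using EffClass.zero
  | succ n ih => simpa [succ_nsmul] using ih.add hα

theorem posRank_of_divClass {D : V → ℤ}
    (h : ∀ v, ∃ β, EffClass G β ∧ divClass G D = _root_.pt G v + β) : PosRank G D := by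
  intro v
  obtain ⟨_, ⟨E, hE, rfl⟩, h⟩ := h v
  refine ⟨Pi.single v 1 + E, fun w => ?_, linEquiv_of_divClass_eq G ?_, ?_⟩
  · by_cases hw : w = v
    · subst hw
      have := hE w
      simp
      omega
    · simpa [hw] using hE w
  · rw [h, map_add]
    rfl
  · simpa using hE v

theorem gonality_le_of_nsmul_pt {n : ℕ} {u : V}
    (h : ∀ v, ∃ β, EffClass G β ∧ n • pt G u = pt G v + β) : gonality G ≤ n := by
  refine Nat.sInf_le ⟨n • Pi.single u 1, fun v => ?_, posRank_of_divClass ?_, ?_⟩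
  · by_cases hv : v = u <;> simp [hv]
  · intro v
    obtain ⟨β, hβ, e⟩ := h v
    exact ⟨β, hβ, by rw [map_nsmul]; exact e⟩
  · simp [degDiv, ← Finset.mul_sum]

end Laplacian
section Moves

variable {V : Type} [Fintype V] {G : SimpleGraph V} {g b : ℕ} {c : ℕ → ZMod b → V}
  {a z : ℕ → ZMod b}

theorem IsCycleChain.lap_indicator (h : IsCycleChain G g b c a z) {p : ℕ → V → ZMod b}
    (hp : IsRetraction g b c a z p) (hb : 3 ≤ b) {i : ℕ} (hi : i < g) (x : ZMod b) :
    lap G (fun v => if p i v = x then 1 else 0) =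
      Pi.single (c i x) 1 + Pi.single (c i x) 1
        - Pi.single (c i (x + 1)) 1 - Pi.single (c i (x - 1)) 1 := by
  ext v
  by_cases hv : ∃ y, c i y = v
  · obtain ⟨y, rfl⟩ := hv
    have := sum_adj_retraction h hp hb hi (fun y => if y = x then (1 : ℤ) else 0) y
    rw [lap, this]
    simp only [Pi.add_apply, Pi.sub_apply, Pi.single_apply, (h.inj i hi).eq_iff]
    simp only [show y + 1 = x ↔ y = x - 1 from eq_sub_iff_add_eq.symm,
      show y - 1 = x ↔ y = x + 1 from sub_eq_iff_eq_add]
    ring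
  · push Not at hv
    have := sum_adj_retraction_of_notMem h hp hi (fun y => if y = x then (1 : ℤ) else 0) hv
    rw [lap, this]
    simp [fun x => (hv x).symm]

theorem IsCycleChain.pt_second_difference (h : IsCycleChain G g b c a z) (hb : 3 ≤ b)
    {i : ℕ} (hi : i < g) (x : ZMod b) :
    pt G (c i (x + 1)) - pt G (c i x) = pt G (c i x) - pt G (c i (x - 1)) := by
  obtain ⟨p, hp⟩ := h.exists_isRetraction
  have := divClass_lap G (fun v => if p i v = x then 1 else 0)
  rw [h.lap_indicator hp hb hi, map_sub, map_sub, map_add] at this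
  change pt G _ + pt G _ - pt G _ - pt G _ = 0 at this
  rw [← sub_eq_zero, ← neg_eq_zero, ← this]
  abel

theorem IsCycleChain.exists_pt_add_natCast (h : IsCycleChain G g b c a z) (hb : 3 ≤ b)
    {i : ℕ} (hi : i < g) :
    ∃ t, b • t = 0 ∧ ∀ (x : ZMod b) (n : ℕ), pt G (c i (x + n)) = pt G (c i x) + n • t := by
  have : NeZero b := ⟨by omega⟩
  have h1 : ∀ n : ℕ, pt G (c i ((n : ZMod b) + 1)) - pt G (c i n) =
      pt G (c i 1) - pt G (c i 0) := by
    intro n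
    induction n with
    | zero => simp
    | succ n ih =>
      rw [h.pt_second_difference hb hi]
      push_cast
      rw [add_sub_cancel_right, ih]
  have h2 : ∀ (x : ZMod b) (n : ℕ),
      pt G (c i (x + n)) = pt G (c i x) + n • (pt G (c i 1) - pt G (c i 0)) := by
    intro x n
    induction n with
    | zero => simp
    | succ n ih =>
      have := h1 (x + n).val
      rw [ZMod.natCast_zmod_val] at this
      rw [succ_nsmul, ← add_assoc, ← ih, ← this]
      push_cast
      rw [← add_assoc]
      abel
  refine ⟨_, ?_, h2⟩
  have := h2 0 b
  simpa using this

/-- A pile of chips on a cycle can be moved around the cycle while leaving one chip behind. -/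
theorem IsCycleChain.nsmul_pt_eq (h : IsCycleChain G g b c a z) (hb : 3 ≤ b)
    {i : ℕ} (hi : i < g) (x y : ZMod b) (n : ℕ) :
    ∃ w, (n + 1) • pt G (c i x) = n • pt G (c i y) + pt G (c i w) := by
  have : NeZero b := ⟨by omega⟩
  obtain ⟨t, -, ht⟩ := h.exists_pt_add_natCast hb hi
  refine ⟨x - (n * (y - x).val : ℕ), ?_⟩
  have e1 := ht x (y - x).val
  have e2 := ht (x - (n * (y - x).val : ℕ)) (n * (y - x).val)
  rw [sub_add_cancel] at e2
  rw [ZMod.natCast_zmod_val, add_sub_cancel] at e1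
  rw [e1, succ_nsmul, nsmul_add, ← mul_nsmul', add_assoc, add_comm (_ • t), ← e2]

theorem IsCycleChain.nsmul_pt_eq_of_dvd (h : IsCycleChain G g b c a z) (hb : 3 ≤ b)
    {i : ℕ} (hi : i < g) {m k : ℕ} (hm : b ∣ m * k) (x : ZMod b) :
    m • pt G (c i (x + k)) = m • pt G (c i x) := by
  obtain ⟨t, h0, ht⟩ := h.exists_pt_add_natCast hb hi
  obtain ⟨q, hq⟩ := hm
  rw [ht, nsmul_add, ← mul_nsmul', hq, mul_comm, mul_nsmul', h0, nsmul_zero, add_zero]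

/-- Two chips on a cycle can be moved to cover any vertex of that cycle. -/
theorem IsCycleChain.exists_effClass_of_two_le (h : IsCycleChain G g b c a z) (hb : 3 ≤ b)
    {i : ℕ} (hi : i < g) {n : ℕ} (hn : 2 ≤ n) (x y : ZMod b) {β} (hβ : EffClass G β) :
    ∃ γ, EffClass G γ ∧ n • pt G (c i x) + β = pt G (c i y) + γ := by
  obtain ⟨n, rfl⟩ := Nat.exists_eq_add_of_le' hn
  obtain ⟨w, hw⟩ := h.nsmul_pt_eq hb hi x y 1
  refine ⟨n • pt G (c i x) + pt G (c i w) + β,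
    (((EffClass.pt _).nsmul n).add (EffClass.pt _)).add hβ, ?_⟩
  rw [add_nsmul, show (2 : ℕ) = 1 + 1 from rfl, hw, one_nsmul]
  abel

end Moves

section Bounds

variable {V : Type} [Fintype V] {G : SimpleGraph V} {g b k : ℕ} {c : ℕ → ZMod b → V}

theorem gonality_le_of_dvd (h : IsCycleChain G g b c (fun _ => 0) (fun _ => k)) (hb : 3 ≤ b)
    {m : ℕ} (hm : 2 ≤ m) (hmk : b ∣ m * k) : gonality G ≤ m := by
  apply gonality_le_of_nsmul_pt (u := c 0 0)
  have key : ∀ i < g, m • pt G (c i 0) = m • pt G (c 0 0) := by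
    intro i
    induction i with
    | zero => simp
    | succ i ih =>
      intro hi
      have := h.nsmul_pt_eq_of_dvd hb (by omega : i < g) hmk 0
      rw [zero_add, h.glue i hi] at this
      rw [this, ih (by omega)]
  intro v
  obtain ⟨i, hi, x, rfl⟩ := h.cover v
  obtain ⟨γ, hγ, e⟩ := h.exists_effClass_of_two_le hb hi hm 0 x EffClass.zero
  rw [add_zero, key i hi] at e
  exact ⟨γ, hγ, e⟩

theorem gonality_le_half (h : IsCycleChain G g b c (fun _ => 0) (fun _ => k)) (hb : 3 ≤ b)
    {d : ℕ} (hd : d + 2 ≤ g) (hgd : g ≤ 2 * d + 2) : gonality G ≤ d + 2 := by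
  apply gonality_le_of_nsmul_pt (u := c (d + 1) 0)
  have right : ∀ n, d + 1 + n < g → ∃ β, EffClass G β ∧
      (d + 2) • pt G (c (d + 1) 0) = (d + 2 - n) • pt G (c (d + 1 + n) 0) + β := by
    intro n
    induction n with
    | zero => exact fun _ => ⟨0, EffClass.zero, by simp⟩
    | succ n ih =>
      intro hn
      obtain ⟨β, hβ, e⟩ := ih (by omega)
      obtain ⟨w, hw⟩ := h.nsmul_pt_eq hb (by omega : d + 1 + n < g) 0 k (d + 2 - (n + 1))
      refine ⟨pt G (c (d + 1 + n) w) + β, (EffClass.pt _).add hβ, ?_⟩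
      rw [h.glue (d + 1 + n) hn] at hw
      rw [e, show d + 2 - n = d + 2 - (n + 1) + 1 by omega, hw, add_assoc]
      rfl
  have left : ∀ n ≤ d, ∃ β, EffClass G β ∧
      (d + 2) • pt G (c (d + 1) 0) = (d + 2 - n) • pt G (c (d - n) k) + β := by
    intro n
    induction n with
    | zero =>
      refine fun _ => ⟨0, EffClass.zero, ?_⟩
      have := h.glue d (by omega)
      simp [this]
    | succ n ih =>
      intro hn
      obtain ⟨β, hβ, e⟩ := ih (by omega)
      obtain ⟨w, hw⟩ := h.nsmul_pt_eq hb (by omega : d - n < g) k 0 (d + 2 - (n + 1))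
      refine ⟨pt G (c (d - n) w) + β, (EffClass.pt _).add hβ, ?_⟩
      have hgl := h.glue (d - (n + 1)) (by omega)
      rw [show d - (n + 1) + 1 = d - n by omega] at hgl
      rw [e, show d + 2 - n = d + 2 - (n + 1) + 1 by omega, hw, add_assoc, hgl]
  intro v
  obtain ⟨i, hi, x, rfl⟩ := h.cover v
  rcases le_or_gt i d with hid | hid
  · obtain ⟨β, hβ, e⟩ := left (d - i) (by omega)
    rw [show d - (d - i) = i by omega] at e
    obtain ⟨γ, hγ, e'⟩ :=
      h.exists_effClass_of_two_le hb hi (by omega : 2 ≤ d + 2 - (d - i)) k x hβ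
    exact ⟨γ, hγ, e.trans e'⟩
  · obtain ⟨β, hβ, e⟩ := right (i - (d + 1)) (by omega)
    rw [show d + 1 + (i - (d + 1)) = i by omega] at e
    obtain ⟨γ, hγ, e'⟩ :=
      h.exists_effClass_of_two_le hb hi (by omega : 2 ≤ d + 2 - (i - (d + 1))) 0 x hβ
    exact ⟨γ, hγ, e.trans e'⟩

/-- If `X ⊆ Y` and `p` is constant on `X` and on the complement of `Y`, then an effective divisor
whose `p`-weighted sum is not the one forced by having exactly `q` chips on `Y`, all on `X`, has
more than `q` chips on `Y`. -/
theorem chips_step {D : V → ℤ} (hD : Effective D) {p : V → ZMod b} {X Y : Finset V}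
    (hXY : X ⊆ Y) {κ κ' : ZMod b} (hX : ∀ v ∈ X, p v = κ) (hY : ∀ v ∉ Y, p v = κ')
    {q : ℕ} (hq : (q : ℤ) ≤ ∑ v ∈ X, D v) {C : ZMod b} (hC : ∑ v, (D v : ZMod b) * p v = C)
    {d : ℕ} (hd : degDiv D = d) :
    ((q + if C = q * κ + (d - q) * κ' then 0 else 1 : ℕ) : ℤ) ≤ ∑ v ∈ Y, D v := by
  have hle : ∑ v ∈ X, D v ≤ ∑ v ∈ Y, D v :=
    Finset.sum_le_sum_of_subset_of_nonneg hXY fun v _ _ => hD v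
  split_ifs with hCq
  · simpa using hq.trans hle
  · by_contra! hlt
    push_cast at hlt
    have hXq : ∑ v ∈ X, D v = q := by omega
    have hYq : ∑ v ∈ Y, D v = q := by omega
    have hz : ∀ v ∈ Y \ X, D v = 0 := by
      have h0 : ∑ v ∈ Y \ X, D v = 0 := by
        have := Finset.sum_sdiff (f := D) hXY
        omega
      exact (Finset.sum_eq_zero_iff_of_nonneg fun v _ => hD v).1 h0
    apply hCq
    have hc : ∑ v ∈ Yᶜ, D v = d - q := by
      have := Finset.sum_add_sum_compl Y D
      rw [degDiv] at hd
      omega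
    rw [← hC, ← Finset.sum_add_sum_compl Y, ← Finset.sum_sdiff hXY,
      Finset.sum_eq_zero fun v hv => by rw [hz v hv]; simp, zero_add,
      Finset.sum_congr rfl fun v hv => by rw [hX v hv],
      Finset.sum_congr (s₁ := Yᶜ) rfl fun v hv => by rw [hY v (by simpa using hv)],
      ← Finset.sum_mul, ← Finset.sum_mul, ← Int.cast_sum, ← Int.cast_sum, hXq, hc]
    push_cast
    rfl

/-- The number of chips stranded by a divisor of degree `d` with invariants `C` in the first
cycles when it is pushed to the right. -/
def strandedLeft (b k d : ℕ) (C : ℕ → ZMod b) : ℕ → ℕ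
  | 0 => 0
  | n + 1 => strandedLeft b k d C n +
      if C n = (d - strandedLeft b k d C n) * k then 0 else 1

/-- The number of chips stranded by a divisor with invariants `C` in the last cycles when it is
pushed to the left. -/
def strandedRight (b k g : ℕ) (C : ℕ → ZMod b) : ℕ → ℕ
  | 0 => 0
  | n + 1 => strandedRight b k g C n +
      if C (g - 1 - n) = strandedRight b k g C n * k then 0 else 1

/-- The vertices lying strictly to the left of the `i`-th cycle. -/
def leftOf (g : ℕ) (c : ℕ → ZMod b → V) (i : ℕ) : Finset V :=
  univ.filter fun v => ∀ j, i ≤ j → j < g → ∀ x, c j x ≠ v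

/-- The vertices lying strictly to the right of the `i`-th cycle. -/
def rightOf (c : ℕ → ZMod b → V) (i : ℕ) : Finset V :=
  univ.filter fun v => ∀ j ≤ i, ∀ x, c j x ≠ v

variable {p : ℕ → V → ZMod b} (h : IsCycleChain G g b c (fun _ => 0) (fun _ => k))
  (hp : IsRetraction g b c (fun _ => 0) (fun _ => k) p)

include h hp

theorem retraction_leftOf {i : ℕ} (hi : i < g) {v : V} (hv : v ∈ leftOf g c i) : p i v = 0 := by
  obtain ⟨j, hj, x, rfl⟩ := h.cover v
  simp only [leftOf, Finset.mem_filter, Finset.mem_univ, true_and] at hv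
  exact hp.left i j x (by by_contra! hij; exact hv j hij hj x rfl) hi

theorem retraction_rightOf {i : ℕ} {v : V} (hv : v ∈ rightOf c i) : p i v = k := by
  obtain ⟨j, hj, x, rfl⟩ := h.cover v
  simp only [rightOf, Finset.mem_filter, Finset.mem_univ, true_and] at hv
  exact hp.right i j x (by by_contra! hij; exact hv j hij x rfl) hj

theorem strandedLeft_le {D : V → ℤ} (hD : Effective D) {C : ℕ → ZMod b}
    (hC : ∀ i < g, ∑ v, (D v : ZMod b) * p i v = C i) {d : ℕ} (hd : degDiv D = d) (n : ℕ)
    (hn : n < g) : (strandedLeft b k d C n : ℤ) ≤ ∑ v ∈ leftOf g c n, D v := by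
  induction n with
  | zero => exact Finset.sum_nonneg fun v _ => hD v
  | succ n ih =>
    have := chips_step (p := p n) (κ := 0) (κ' := k) (X := leftOf g c n) (Y := leftOf g c (n + 1))
      hD ?_ (fun v hv => retraction_leftOf h hp (by omega) hv) ?_ (ih (by omega))
      (hC n (by omega)) hd
    · rwa [mul_zero, zero_add] at this
    · intro v hv
      simp only [leftOf, Finset.mem_filter, Finset.mem_univ, true_and] at hv ⊢
      exact fun j hj => hv j (by omega)
    · intro v hv
      simp only [leftOf, Finset.mem_filter, Finset.mem_univ, true_and] at hv
      push Not at hv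
      obtain ⟨j, hj, hjg, x, rfl⟩ := hv
      exact hp.right n j x (by omega) hjg

theorem strandedRight_le {D : V → ℤ} (hD : Effective D) {C : ℕ → ZMod b}
    (hC : ∀ i < g, ∑ v, (D v : ZMod b) * p i v = C i) {d : ℕ} (hd : degDiv D = d) (n : ℕ)
    (hn : n < g) : (strandedRight b k g C n : ℤ) ≤ ∑ v ∈ rightOf c (g - 1 - n), D v := by
  induction n with
  | zero => exact Finset.sum_nonneg fun v _ => hD v
  | succ n ih =>
    have := chips_step (p := p (g - 1 - n)) (κ := k) (κ' := 0) (X := rightOf c (g - 1 - n))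
      (Y := rightOf c (g - 1 - (n + 1)))
      hD ?_ (fun v hv => retraction_rightOf h hp hv) ?_ (ih (by omega))
      (hC _ (by omega)) hd
    · rwa [mul_zero, add_zero] at this
    · intro v hv
      simp only [rightOf, Finset.mem_filter, Finset.mem_univ, true_and] at hv ⊢
      exact fun j hj => hv j (by omega)
    · intro v hv
      simp only [rightOf, Finset.mem_filter, Finset.mem_univ, true_and] at hv
      push Not at hv
      obtain ⟨j, hj, x, rfl⟩ := hv
      exact hp.left _ j x (by omega) (by omega)

theorem stranded_add_two_le (hb : 3 ≤ b) {D : V → ℤ} (hD : PosRank G D) {d : ℕ}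
    (hd : degDiv D = d) {i : ℕ} (hi : i < g) {C : ℕ → ZMod b}
    (hC : ∀ i < g, ∑ v, (D v : ZMod b) * p i v = C i) :
    strandedLeft b k d C i + strandedRight b k g C (g - 1 - i) + 2 ≤ d := by
  have : Fact (1 < b) := ⟨by omega⟩
  by_contra! hlt
  obtain ⟨x, hx⟩ := exists_ne (C i - strandedRight b k g C (g - 1 - i) * k)
  obtain ⟨E, hE, hDE, hv⟩ := hD (c i x)
  have hdE : degDiv E = d := hDE.degDiv_eq.trans hd
  have hCE : ∀ i < g, ∑ v, (E v : ZMod b) * p i v = C i := fun j hj =>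
    (hDE.sum_mul_retraction h hp hb hj).trans (hC j hj)
  have hL := strandedLeft_le h hp hE hCE hdE i hi
  have hR := strandedRight_le h hp hE hCE hdE (g - 1 - i) (by omega)
  rw [show g - 1 - (g - 1 - i) = i by omega] at hR
  set L := leftOf g c i with hLdef
  set R := rightOf c i with hRdef
  have hvL : c i x ∉ L := by
    simp only [hLdef, leftOf, Finset.mem_filter, Finset.mem_univ, true_and]
    exact fun h' => h' i le_rfl hi x rfl
  have hvR : c i x ∉ R := by
    simp only [hRdef, rightOf, Finset.mem_filter, Finset.mem_univ, true_and]
    exact fun h' => h' i le_rfl x rfl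
  have hLR : Disjoint R L := by
    rw [Finset.disjoint_left]
    intro v hvR hvL
    simp only [hLdef, leftOf, Finset.mem_filter, Finset.mem_univ, true_and] at hvL
    simp only [hRdef, rightOf, Finset.mem_filter, Finset.mem_univ, true_and] at hvR
    obtain ⟨j, hj, y, rfl⟩ := h.cover v
    rcases le_total i j with hij | hij
    · exact hvL j hij hj y rfl
    · exact hvR j hij y rfl
  have hvRL : c i x ∉ R ∪ L := by simp [hvL, hvR]
  set T := insert (c i x) (R ∪ L) with hT
  have hsum := Finset.sum_add_sum_compl T E
  rw [hT, Finset.sum_insert hvRL, Finset.sum_union hLR, ← hT] at hsum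
  rw [degDiv] at hdE
  have hTnn : 0 ≤ ∑ v ∈ Tᶜ, E v := Finset.sum_nonneg fun v _ => hE v
  have hT0 : ∑ v ∈ Tᶜ, E v = 0 := by omega
  have hR0 : ∑ v ∈ R, E v = strandedRight b k g C (g - 1 - i) := by omega
  have hE1 : E (c i x) = 1 := by omega
  have hz := (Finset.sum_eq_zero_iff_of_nonneg fun v _ => hE v).1 hT0
  apply hx
  rw [← hCE i hi, ← Finset.sum_add_sum_compl T,
    Finset.sum_eq_zero (s := Tᶜ) fun v hv => by rw [hz v hv]; simp, add_zero, hT,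
    Finset.sum_insert hvRL, Finset.sum_union hLR,
    Finset.sum_eq_zero (s := L) fun v hv => by rw [retraction_leftOf h hp hi hv, mul_zero],
    Finset.sum_congr (s₁ := R) rfl fun v hv => by rw [retraction_rightOf h hp hv],
    ← Finset.sum_mul, ← Int.cast_sum, hR0, hE1, hp.same i hi]
  push_cast
  ring

theorem le_degree_of_posRank (hb : 3 ≤ b) (hg : 0 < g) {D : V → ℤ} (hD : PosRank G D) {d : ℕ}
    (hd : degDiv D = d) (hk : ∀ t, 1 ≤ t → t ≤ d → ¬ b ∣ t * k) : g + 2 ≤ 2 * d := by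
  set C : ℕ → ZMod b := fun i => ∑ v, (D v : ZMod b) * p i v with hC
  have key : ∀ i < g, strandedLeft b k d C i + strandedRight b k g C (g - 1 - i) + 2 ≤ d :=
    fun i hi => stranded_add_two_le h hp hb hD hd hi fun _ _ => rfl
  have step : ∀ i ≤ g, i + strandedRight b k g C (g - i) ≤
      strandedLeft b k d C i + strandedRight b k g C g := by
    intro i
    induction i with
    | zero => simp
    | succ i ih =>
      intro hi
      have h1 := ih (by omega)
      have h2 := key i (by omega)
      rw [show g - i = (g - 1 - i) + 1 by omega, strandedRight,
        show g - 1 - (g - 1 - i) = i by omega] at h1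
      rw [show g - (i + 1) = g - 1 - i by omega, strandedLeft]
      set l := strandedLeft b k d C i
      set r := strandedRight b k g C (g - 1 - i)
      split_ifs at h1 ⊢ with h3 h4
      · exfalso
        apply hk (d - l - r) (by omega) (by omega)
        rw [← ZMod.natCast_eq_zero_iff]
        push_cast [Nat.cast_sub (by omega : r ≤ d - l), Nat.cast_sub (by omega : l ≤ d)]
        linear_combination h4 - h3
      all_goals omega
  have h1 := step g le_rfl
  have h2 := key (g - 1) (by omega)
  have h3 := key 0 hg
  obtain ⟨g, rfl⟩ := Nat.exists_eq_add_of_lt hg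
  simp only [zero_add, add_tsub_cancel_right, Nat.sub_self, Nat.sub_zero, strandedLeft,
    strandedRight] at *
  split_ifs at h1 <;> omega

end Bounds

theorem gonality_of_isCycleChain {V : Type} [Fintype V] {G : SimpleGraph V} {g b k : ℕ}
    {c : ℕ → ZMod b → V} (h : IsCycleChain G g b c (fun _ => 0) (fun _ => k)) (hg : 3 ≤ g)
    (hb : 3 ≤ b) (hk : (k : ZMod b) ≠ 0) :
    gonality G = min ((g + 3) / 2) (sInf {t : ℕ | 1 ≤ t ∧ t ≤ b ∧ b ∣ t * k}) := by
  obtain ⟨p, hp⟩ := h.exists_isRetraction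
  have hm : sInf {t : ℕ | 1 ≤ t ∧ t ≤ b ∧ b ∣ t * k} ∈ {t : ℕ | 1 ≤ t ∧ t ≤ b ∧ b ∣ t * k} :=
    Nat.sInf_mem ⟨b, by omega, le_rfl, dvd_mul_right b k⟩
  set m := sInf {t : ℕ | 1 ≤ t ∧ t ≤ b ∧ b ∣ t * k} with hmdef
  obtain ⟨hm1, hmb, hmk⟩ := hm
  have hm2 : 2 ≤ m := by
    by_contra! hlt
    rw [show m = 1 by omega, one_mul, ← ZMod.natCast_eq_zero_iff] at hmk
    exact hk hmk
  apply le_antisymm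
  · refine le_min ?_ (gonality_le_of_dvd h hb hm2 hmk)
    have := gonality_le_half h hb (d := (g + 3) / 2 - 2) (by omega) (by omega)
    omega
  · have hne : {n : ℕ | ∃ D : V → ℤ, Effective D ∧ PosRank G D ∧ degDiv D = (n : ℤ)}.Nonempty := by
      refine ⟨Fintype.card V, fun _ => 1, fun _ => zero_le_one, fun v => ?_, by simp [degDiv]⟩
      refine ⟨fun _ => 1, fun _ => zero_le_one, ⟨0, ?_⟩, le_rfl⟩
      ext v
      simp [lap]
    obtain ⟨D, -, hD, hd⟩ := Nat.sInf_mem hne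
    change degDiv D = (gonality G : ℤ) at hd
    by_contra! hlt
    rw [lt_min_iff] at hlt
    have := le_degree_of_posRank h hp hb (by omega) hD hd fun t h1 h2 h3 =>
      absurd (Nat.sInf_le (s := {t : ℕ | 1 ≤ t ∧ t ≤ b ∧ b ∣ t * k}) ⟨h1, by omega, h3⟩)
        (by omega)
    omega
section Normalize

variable {V : Type} {G : SimpleGraph V} {g b : ℕ} {c : ℕ → ZMod b → V} {a z : ℕ → ZMod b}

theorem IsCycleChain.dist_add_natCast_le (h : IsCycleChain G g b c a z) (hG : G.Connected)
    {i : ℕ} (hi : i < g) (x : ZMod b) (n : ℕ) : G.dist (c i x) (c i (x + n)) ≤ n := by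
  induction n with
  | zero => simp
  | succ n ih =>
    have hadj : G.Adj (c i (x + n)) (c i (x + (n + 1 : ℕ))) :=
      (h.adj _ _).2 ⟨i, hi, _, _, rfl, rfl, Or.inr (by push_cast; ring)⟩
    have h1 := hG.dist_triangle (u := c i x) (v := c i (x + n)) (w := c i (x + (n + 1 : ℕ)))
    have h2 := SimpleGraph.dist_eq_one_iff_adj.2 hadj
    omega

theorem IsCycleChain.exists_retraction_eq_add (h : IsCycleChain G g b c a z)
    {p : ℕ → V → ZMod b} (hp : IsRetraction g b c a z p) {i : ℕ} (hi : i < g) {v w : V}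
    (q : G.Walk v w) : ∃ n : ℤ, |n| ≤ q.length ∧ p i w = p i v + n := by
  induction q with
  | nil => exact ⟨0, by simp⟩
  | cons hvw q ih =>
    obtain ⟨n, hn, e⟩ := ih
    rw [SimpleGraph.Walk.length_cons]
    rcases h.adj_retraction hp hi hvw with h1 | ⟨x, y, rfl, rfl, h1 | h1⟩
    · exact ⟨n, by push_cast; omega, by rw [e, h1]⟩
    · refine ⟨n - 1, by push_cast; rw [abs_le] at *; omega, ?_⟩
      rw [e, hp.same i hi, hp.same i hi]
      push_cast
      linear_combination -h1
    · refine ⟨n + 1, by push_cast; rw [abs_le] at *; omega, ?_⟩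
      rw [e, hp.same i hi, hp.same i hi]
      push_cast
      linear_combination h1

theorem IsCycleChain.eq_add_or_eq_sub_of_dist (h : IsCycleChain G g b c a z)
    (hG : G.Connected) {i : ℕ} (hi : i < g) {x y : ZMod b} {k : ℕ}
    (hk : G.dist (c i x) (c i y) = k) : y = x + k ∨ y = x - k := by
  obtain ⟨p, hp⟩ := h.exists_isRetraction
  obtain ⟨q, hq⟩ := hG.exists_walk_length_eq_dist (c i x) (c i y)
  obtain ⟨n, hn, e⟩ := h.exists_retraction_eq_add hp hi q
  rw [hp.same i hi, hp.same i hi] at e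
  rw [hq, hk] at hn
  obtain ⟨m, rfl | rfl⟩ := n.eq_nat_or_neg
  · have h1 := h.dist_add_natCast_le hG hi x m
    left
    push_cast at e
    rw [← e, hk] at h1
    rw [Nat.abs_cast] at hn
    rw [e, show m = k by omega]
  · have h1 := h.dist_add_natCast_le hG hi y m
    right
    push_cast at e
    rw [show y + m = x by rw [e]; ring, SimpleGraph.dist_comm, hk] at h1
    rw [abs_neg, Nat.abs_cast] at hn
    rw [e, show m = k by omega]
    ring

/-- A chain in which consecutive gluing points are at distance `k` can be reparametrised so that
the gluing points of each cycle are `0` and `k`. -/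
theorem IsCycleChain.exists_normalized (h : IsCycleChain G g b c a z) (hG : G.Connected) {k : ℕ}
    (hk : ∀ i, 1 ≤ i → i + 1 < g → G.dist (c i (a i)) (c i (z i)) = k) :
    ∃ c', IsCycleChain G g b c' (fun _ => 0) (fun _ => k) := by
  have hu : ∀ i, ∃ u ε : ZMod b, (ε = 1 ∨ ε = -1) ∧ (1 ≤ i → i < g → u = a i) ∧
      (i + 1 < g → u + ε * k = z i) := by
    intro i
    by_cases h1 : 1 ≤ i
    · by_cases h2 : i + 1 < g
      · rcases h.eq_add_or_eq_sub_of_dist hG (by omega) (hk i h1 h2) with e | e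
        · exact ⟨a i, 1, Or.inl rfl, fun _ _ => rfl, fun _ => by rw [e]; ring⟩
        · exact ⟨a i, -1, Or.inr rfl, fun _ _ => rfl, fun _ => by rw [e]; ring⟩
      · exact ⟨a i, 1, Or.inl rfl, fun _ _ => rfl, fun h => absurd h h2⟩
    · exact ⟨z i - k, 1, Or.inl rfl, fun h => absurd h h1, fun _ => by ring⟩
  choose u ε hε hua huz using hu
  have hεε : ∀ i, ε i * ε i = 1 := fun i => by rcases hε i with e | e <;> rw [e] <;> ring
  refine ⟨fun i x => c i (u i + ε i * x), ?_, ?_, ?_, ?_, ?_⟩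
  · intro i hi x y hxy
    have := h.inj i hi hxy
    linear_combination ε i * this - (x - y) * hεε i
  · intro i hi
    rw [huz i hi, h.glue i hi, mul_zero, add_zero, hua (i + 1) (by omega) hi]
  · intro i j x y hij hj hxy
    obtain ⟨rfl, h1, h2⟩ := h.meet i j _ _ hij hj hxy
    refine ⟨rfl, ?_, ?_⟩
    · rw [← huz i hj] at h1
      linear_combination ε i * h1 - (x - k) * hεε i
    · rw [← hua (i + 1) (by omega) hj] at h2
      linear_combination ε (i + 1) * h2 - y * hεε (i + 1)
  · intro v
    obtain ⟨i, hi, x, rfl⟩ := h.cover v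
    exact ⟨i, hi, ε i * (x - u i), congrArg (c i) (by linear_combination (x - u i) * hεε i)⟩
  · intro v w
    rw [h.adj]
    refine exists_congr fun i => and_congr_right fun hi => ?_
    constructor
    · rintro ⟨x, y, rfl, rfl, hxy⟩
      refine ⟨ε i * (x - u i), ε i * (y - u i),
        congrArg (c i) (by linear_combination (x - u i) * hεε i),
        congrArg (c i) (by linear_combination (y - u i) * hεε i), ?_⟩
      rcases hε i with e | e <;> rw [e]
      · exact hxy.imp (fun e => by linear_combination e) (fun e => by linear_combination e)
      · exact hxy.symm.imp (fun e => by linear_combination e) (fun e => by linear_combination e)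
    · rintro ⟨x, y, rfl, rfl, hxy⟩
      refine ⟨_, _, rfl, rfl, ?_⟩
      rcases hε i with e | e <;> rw [e]
      · exact hxy.imp (fun e => by linear_combination e) (fun e => by linear_combination e)
      · exact hxy.symm.imp (fun e => by linear_combination e) (fun e => by linear_combination e)

end Normalize

section Blocks

variable {V : Type} {G : SimpleGraph V}

/-- A subgraph is 2-connected if it has more than two vertices and stays connected when at most
one vertex is removed. -/
def TwoConnected [Fintype V] (H : G.Subgraph) : Prop :=
  2 < Fintype.card H.verts ∧ ∀ S : Set V, S.Subsingleton → (H.deleteVerts S).Connected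

/-- Removing vertices from the coercion of a subgraph agrees with `Subgraph.deleteVerts`. -/
def induceComplIso (H : G.Subgraph) (S : Set V) (T : Set H.verts)
    (hST : ∀ v : H.verts, v ∈ T ↔ (v : V) ∈ S) :
    H.coe.induce Tᶜ ≃g (H.deleteVerts S).coe where
  toFun v := ⟨v.1.1, v.1.2, fun h => v.2 ((hST _).2 h)⟩
  invFun v := ⟨⟨v.1, v.2.1⟩, fun h => v.2.2 ((hST _).1 h)⟩
  left_inv _ := rfl
  right_inv _ := rfl
  map_rel_iff' {u v} := by
    have hu : (u.1 : V) ∉ S := fun h => u.2 ((hST _).2 h)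
    have hv : (v.1 : V) ∉ S := fun h => v.2 ((hST _).2 h)
    simp [hu, hv]

theorem kConnected_two_iff [Fintype V] (H : G.Subgraph) :
    KConnected H.coe 2 ↔ TwoConnected H := by
  refine and_congr_right fun _ => ⟨fun h S hS => ?_, fun h T hT => ?_⟩
  · have hT : ({v : H.verts | (v : V) ∈ S}.toFinset).card < 2 := by
      rw [Nat.lt_succ_iff, Finset.card_le_one]
      intro u hu v hv
      exact Subtype.ext (hS (by simpa using hu) (by simpa using hv))
    exact ⟨(induceComplIso H S _ (by simp)).connected_iff.1 (h _ hT)⟩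
  · refine (induceComplIso H (Subtype.val '' (T : Set H.verts)) _ (by simp)).connected_iff.2
      (h _ ?_).coe
    rw [Nat.lt_succ_iff, Finset.card_le_one] at hT
    rintro _ ⟨u, hu, rfl⟩ _ ⟨v, hv, rfl⟩
    rw [hT u hu v hv]

theorem card_verts_le_of_le [Fintype V] {H K : G.Subgraph} (h : H ≤ K) :
    Fintype.card H.verts ≤ Fintype.card K.verts :=
  Fintype.card_le_of_injective (Set.inclusion h.1) (Set.inclusion_injective h.1)

theorem subgraph_connected_of_forall {H K : G.Subgraph} (hH : H.Connected) (hle : H ≤ K)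
    (h : ∀ y ∈ K.verts, ∃ W ≤ K, W.Connected ∧ y ∈ W.verts ∧ (W.verts ∩ H.verts).Nonempty) :
    K.Connected := by
  obtain ⟨u, hu⟩ := hH.nonempty
  rw [Subgraph.connected_iff', connected_iff_exists_forall_reachable]
  refine ⟨⟨u, hle.1 hu⟩, fun ⟨y, hy⟩ => ?_⟩
  obtain ⟨W, hWK, hW, hyW, x, hxW, hxH⟩ := h y hy
  exact ((hH.coe ⟨u, hu⟩ ⟨x, hxH⟩).map (Subgraph.inclusion hle)).trans
    ((hW.coe ⟨x, hxW⟩ ⟨y, hyW⟩).map (Subgraph.inclusion hWK))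

theorem le_deleteVerts_of_disjoint {W K : G.Subgraph} (h : W ≤ K) {S : Set V}
    (hS : ∀ v ∈ W.verts, v ∉ S) : W ≤ K.deleteVerts S := by
  refine ⟨fun v hv => ⟨h.1 hv, hS v hv⟩, fun u v huv => ?_⟩
  rw [Subgraph.deleteVerts_adj]
  exact ⟨h.1 huv.fst_mem, hS u huv.fst_mem, h.1 huv.snd_mem, hS v huv.snd_mem, h.2 huv⟩

theorem TwoConnected.sup [Fintype V] {H K : G.Subgraph} (hH : TwoConnected H)
    (hK : TwoConnected K) {u v : V} (huv : u ≠ v) (huH : u ∈ H.verts) (huK : u ∈ K.verts)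
    (hvH : v ∈ H.verts) (hvK : v ∈ K.verts) : TwoConnected (H ⊔ K) := by
  refine ⟨hH.1.trans_le (card_verts_le_of_le le_sup_left), fun S hS => ?_⟩
  refine subgraph_connected_of_forall (hH.2 S hS) (Subgraph.deleteVerts_mono le_sup_left) ?_
  rintro y ⟨hy | hy, hyS⟩
  · exact ⟨_, Subgraph.deleteVerts_mono le_sup_left, hH.2 S hS, ⟨hy, hyS⟩, y, ⟨hy, hyS⟩, hy, hyS⟩
  · refine ⟨_, Subgraph.deleteVerts_mono le_sup_right, hK.2 S hS, ⟨hy, hyS⟩, ?_⟩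
    by_cases hu : u ∈ S
    · have hv : v ∉ S := fun hv => huv (hS hu hv)
      exact ⟨v, ⟨hvK, hv⟩, hvH, hv⟩
    · exact ⟨u, ⟨huK, hu⟩, huH, hu⟩

/-- Adding an ear to a 2-connected subgraph gives a 2-connected subgraph. -/
theorem TwoConnected.sup_path [Fintype V] {H : G.Subgraph} (hH : TwoConnected H) {u v : V}
    (hu : u ∈ H.verts) (hv : v ∈ H.verts) {q : G.Walk u v} (hq : q.IsPath) :
    TwoConnected (H ⊔ q.toSubgraph) := by
  refine ⟨hH.1.trans_le (card_verts_le_of_le le_sup_left), fun S hS => ?_⟩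
  refine subgraph_connected_of_forall (hH.2 S hS) (Subgraph.deleteVerts_mono le_sup_left) ?_
  rintro y ⟨hy | hy, hyS⟩
  · exact ⟨_, Subgraph.deleteVerts_mono le_sup_left, hH.2 S hS, ⟨hy, hyS⟩, y, ⟨hy, hyS⟩, hy, hyS⟩
  · rw [Walk.mem_verts_toSubgraph, hq.mem_support_iff_exists_append] at hy
    obtain ⟨q₁, q₂, -, -, rfl⟩ := hy
    rw [Walk.toSubgraph_append]
    by_cases h1 : ∀ s ∈ q₁.toSubgraph.verts, s ∉ S
    · exact ⟨q₁.toSubgraph, le_deleteVerts_of_disjoint (le_sup_left.trans le_sup_right) h1,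
        q₁.toSubgraph_connected, q₁.end_mem_verts_toSubgraph, u, q₁.start_mem_verts_toSubgraph,
        hu, h1 u q₁.start_mem_verts_toSubgraph⟩
    · push Not at h1
      obtain ⟨s, hs, hsS⟩ := h1
      have h2 : ∀ s ∈ q₂.toSubgraph.verts, s ∉ S := by
        intro t ht htS
        obtain rfl := hS hsS htS
        rw [Walk.mem_verts_toSubgraph] at hs ht
        exact hq.ne_of_mem_support_of_append (fun e => hyS (e ▸ hsS)) hs ht rfl
      exact ⟨q₂.toSubgraph, le_deleteVerts_of_disjoint (le_sup_right.trans le_sup_right) h2,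
        q₂.toSubgraph_connected, q₂.start_mem_verts_toSubgraph, v, q₂.end_mem_verts_toSubgraph,
        hv, h2 v q₂.end_mem_verts_toSubgraph⟩

variable [Fintype V]

theorem IsBlock.eq_of_le {B H : G.Subgraph} (hB : IsBlock G B) (hH : TwoConnected H)
    (h : B ≤ H) : B = H := by
  by_contra hne
  exact hB.1 ⟨H, (kConnected_two_iff H).2 hH, lt_of_le_of_ne h hne⟩

theorem IsBlock.eq_of_mem_of_mem {B B' : G.Subgraph} (hB : IsBlock G B) (hB' : IsBlock G B')
    (h : TwoConnected B) (h' : TwoConnected B') {u v : V} (huv : u ≠ v) (hu : u ∈ B.verts)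
    (hu' : u ∈ B'.verts) (hv : v ∈ B.verts) (hv' : v ∈ B'.verts) : B = B' :=
  (hB.eq_of_le (h.sup h' huv hu hu' hv hv') le_sup_left).trans
    (hB'.eq_of_le (h.sup h' huv hu hu' hv hv') le_sup_right).symm

theorem exists_isBlock_adj {u v : V} (huv : G.Adj u v) : ∃ B, IsBlock G B ∧ B.Adj u v := by
  by_cases h : ∃ H : G.Subgraph, TwoConnected H ∧ H.Adj u v
  · obtain ⟨H, hH⟩ := h
    obtain ⟨B, -, hB⟩ := (Set.toFinite {H : G.Subgraph | TwoConnected H ∧ H.Adj u v}).exists_le_maximal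
      hH
    refine ⟨B, ⟨?_, Or.inl ((kConnected_two_iff B).2 hB.1.1)⟩, hB.1.2⟩
    rintro ⟨K, hK, hlt⟩
    exact hlt.not_ge (hB.2 ⟨(kConnected_two_iff K).1 hK, hlt.le.2 hB.1.2⟩ hlt.le)
  · refine ⟨G.subgraphOfAdj huv, ⟨?_, Or.inr ⟨u, v, huv.ne, rfl, by simp⟩⟩, by simp⟩
    rintro ⟨K, hK, hlt⟩
    exact h ⟨K, (kConnected_two_iff K).1 hK, hlt.le.2 (by simp)⟩

theorem TwoConnected.exists_mem_ne {B : G.Subgraph} (h : TwoConnected B) (v : V) :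
    ∃ u ∈ B.verts, u ≠ v := by
  obtain ⟨u, hu, huv⟩ := (h.2 {v} Set.subsingleton_singleton).nonempty
  exact ⟨u, hu, huv⟩

theorem IsBlock.adj_of_not_isCutVertex {B : G.Subgraph} (hB : IsBlock G B) (h : TwoConnected B)
    {v x : V} (hv : v ∈ B.verts) (hcut : ¬ IsCutVertex G v) (hvx : G.Adj v x) : B.Adj v x := by
  obtain ⟨u, hu, huv⟩ := h.exists_mem_ne v
  rw [IsCutVertex, not_not] at hcut
  obtain ⟨q, hq⟩ := hcut.exists_isPath ⟨x, hvx.ne'⟩ ⟨u, huv⟩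
  have hq' := hq.map (f := (Embedding.induce ({v}ᶜ : Set V)).toHom) Subtype.val_injective
  have hqv : v ∉ (q.map (Embedding.induce ({v}ᶜ : Set V)).toHom).support := by
    rw [Walk.support_map]
    intro hmem
    obtain ⟨w, -, hw⟩ := List.mem_map.1 hmem
    exact w.2 hw
  have := h.sup_path hv hu (hq'.cons (h := hvx) hqv)
  rw [hB.eq_of_le this le_sup_left]
  right
  simp

theorem isCutVertex_of_mem_of_mem {B B' : G.Subgraph} (hB : IsBlock G B) (hB' : IsBlock G B')
    (h : TwoConnected B) (h' : TwoConnected B') (hne : B ≠ B') {v : V} (hv : v ∈ B.verts)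
    (hv' : v ∈ B'.verts) : IsCutVertex G v := by
  by_contra hcut
  have hconn : B'.Connected := by
    simpa using h'.2 ∅ Set.subsingleton_empty
  obtain ⟨u, hu, huv⟩ := h'.exists_mem_ne v
  have : Nontrivial B'.verts := ⟨⟨v, hv'⟩, ⟨u, hu⟩, fun e => huv (congrArg Subtype.val e).symm⟩
  obtain ⟨x, hx⟩ := hconn.preconnected.exists_adj_of_nontrivial ⟨v, hv'⟩
  have hx' := hB.adj_of_not_isCutVertex h hv hcut hx.adj_sub
  exact hne (hB.eq_of_mem_of_mem hB' h h' hx.adj_sub.ne hv hv' hx'.snd_mem hx.snd_mem)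

theorem exists_isBlock_ne_of_isCutVertex (hG : G.Connected) {B : G.Subgraph}
    (h : TwoConnected B) {v : V} (hv : v ∈ B.verts) (hcut : IsCutVertex G v) :
    ∃ B', IsBlock G B' ∧ B' ≠ B ∧ v ∈ B'.verts := by
  by_contra! hall
  apply hcut
  have hnb : ∀ x, G.Adj v x → x ∈ B.verts := by
    intro x hx
    obtain ⟨B', hB', hadj⟩ := exists_isBlock_adj hx
    by_cases e : B' = B
    · exact e ▸ hadj.snd_mem
    · exact absurd hadj.fst_mem (hall B' hB' e)
  have hBv := h.2 {v} Set.subsingleton_singleton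
  let f : (B.deleteVerts {v}).coe →g G.induce ({v}ᶜ : Set V) :=
    { toFun := fun u => ⟨u.1, u.2.2⟩
      map_rel' := fun {u w} huw => Subgraph.adj_sub (B.deleteVerts {v}) huw }
  have hreach : ∀ (u : V) (hu : u ≠ v), G.Walk u v →
      ∃ x : (B.deleteVerts {v}).verts, (G.induce ({v}ᶜ : Set V)).Reachable ⟨u, hu⟩ (f x) := by
    intro u hu q
    induction q with
    | nil => exact absurd rfl hu
    | @cons u w v huw q ih =>
      by_cases hw : w = v
      · subst hw
        exact ⟨⟨u, hnb u huw.symm, hu⟩, Reachable.refl _⟩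
      · obtain ⟨x, hx⟩ := ih hv hcut hall hnb hBv hw
        have hadj : (G.induce ({v}ᶜ : Set V)).Adj ⟨u, hu⟩ ⟨w, hw⟩ := huw
        exact ⟨x, hadj.reachable.trans hx⟩
  obtain ⟨x₀⟩ := hBv.coe.nonempty
  rw [connected_iff_exists_forall_reachable]
  refine ⟨f x₀, fun ⟨u, hu⟩ => ?_⟩
  obtain ⟨x, hx⟩ := hreach u hu (hG u v).some
  exact ((hBv.coe x₀ x).map f).trans hx.symm

theorem exists_isBlock_mem [Nontrivial V] (hG : G.Connected) (v : V) :
    ∃ B, IsBlock G B ∧ v ∈ B.verts := by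
  obtain ⟨u, hu⟩ := hG.preconnected.exists_adj_of_nontrivial v
  obtain ⟨B, hB, hadj⟩ := exists_isBlock_adj hu
  exact ⟨B, hB, hadj.fst_mem⟩

end Blocks

section PathTree

/-- The two vertex classes of a bipartite path, enumerated along the path, when every vertex of
the first class has two neighbours. -/
theorem exists_enumeration_of_iso_pathGraph {C D : Type} [Finite D] {T : SimpleGraph (C ⊕ D)}
    {r g : ℕ} (e : T ≃g pathGraph r) (hC : ∀ c c', ¬ T.Adj (Sum.inl c) (Sum.inl c'))
    (hD : ∀ d d', ¬ T.Adj (Sum.inr d) (Sum.inr d'))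
    (htwo : ∀ c, ∃ d d', d ≠ d' ∧ T.Adj (Sum.inl c) (Sum.inr d) ∧ T.Adj (Sum.inl c) (Sum.inr d'))
    (hg : Nat.card D = g) (hg1 : 1 < g) :
    ∃ (B : ℕ → D) (w : ℕ → C), (∀ d, ∃ i < g, B i = d) ∧
      (∀ i j, i < g → j < g → B i = B j → i = j) ∧ (∀ c, ∃ i, i + 1 < g ∧ w i = c) ∧
      ∀ i j, i + 1 < g → j < g →
        (T.Adj (Sum.inl (w i)) (Sum.inr (B j)) ↔ j = i ∨ j = i + 1) := by
  obtain ⟨f, hf, hfr, hsurj, hadj⟩ : ∃ f : C ⊕ D → ℕ, Function.Injective f ∧ (∀ x, f x < r) ∧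
      (∀ n < r, ∃ x, f x = n) ∧ ∀ x y, T.Adj x y ↔ f x + 1 = f y ∨ f y + 1 = f x := by
    refine ⟨fun x => (e x).val, Fin.val_injective.comp e.injective, fun x => (e x).isLt,
      fun n hn => ⟨e.symm ⟨n, hn⟩, by simp⟩, fun x y => ?_⟩
    rw [← e.map_adj_iff, pathGraph_adj]
  have hint : ∀ c, 1 ≤ f (Sum.inl c) ∧ f (Sum.inl c) + 1 < r := by
    intro c
    obtain ⟨d, d', hne, h, h'⟩ := htwo c
    have hne' : f (Sum.inr d) ≠ f (Sum.inr d') := fun h => hne (Sum.inr_injective (hf h))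
    rw [hadj] at h h'
    have := hfr (Sum.inr d)
    have := hfr (Sum.inr d')
    omega
  have hparity : ∀ n x, f x = n → (x.isRight = true ↔ Even n) := by
    intro n
    induction n with
    | zero =>
      rintro (c | d) hx
      · have := hint c
        omega
      · simp
    | succ n ih =>
      intro x hx
      obtain ⟨y, hy⟩ := hsurj n (by have := hfr x; omega)
      have hxy : T.Adj y x := (hadj _ _).2 (by omega)
      rw [Nat.even_add_one, ← ih y hy]
      rcases x with c | d <;> rcases y with c' | d'
      · exact absurd hxy (hC _ _)
      · simp
      · simp
      · exact absurd hxy (hD _ _)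
  have hDne : Nonempty D := (Nat.card_pos_iff.1 (hg ▸ Nat.zero_lt_of_lt hg1)).1
  have hr : 0 < r := (Nat.zero_le _).trans_lt (hfr (Sum.inr hDne.some))
  obtain ⟨q, hq⟩ : ∃ q, r = 2 * q + 1 := by
    obtain ⟨x, hx⟩ := hsurj (r - 1) (by omega)
    have hp := hparity _ x hx
    rcases x with c | d
    · have := hint c
      omega
    · obtain ⟨q, hq⟩ := hp.1 rfl
      exact ⟨q, by omega⟩
  have hB : ∀ i, ∃ d, i < q + 1 → f (Sum.inr d) = 2 * i := by
    intro i
    by_cases hi : i < q + 1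
    · obtain ⟨x, hx⟩ := hsurj (2 * i) (by omega)
      have hp := hparity _ x hx
      rcases x with c | d
      · simp at hp
      · exact ⟨d, fun _ => hx⟩
    · exact ⟨hDne.some, fun h => absurd h hi⟩
  choose B hB using hB
  have hBsurj : ∀ d, ∃ i < q + 1, B i = d := by
    intro d
    obtain ⟨i, hi⟩ := (hparity _ (Sum.inr d) rfl).1 rfl
    have := hfr (Sum.inr d)
    refine ⟨i, by omega, Sum.inr_injective (hf ?_)⟩
    rw [hB i (by omega), hi, two_mul]
  have hBinj : ∀ i j, i < q + 1 → j < q + 1 → B i = B j → i = j := by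
    intro i j hi hj hij
    have h1 := hB i hi
    have h2 := hB j hj
    rw [hij] at h1
    omega
  have hgq : g = q + 1 := by
    have hbij : Function.Bijective fun i : Fin (q + 1) => B i :=
      ⟨fun i j hij => Fin.ext (hBinj i j i.2 j.2 hij), fun d =>
        let ⟨i, hi, h⟩ := hBsurj d
        ⟨⟨i, hi⟩, h⟩⟩
    rw [← hg, ← Nat.card_eq_of_bijective _ hbij, Nat.card_fin]
  subst hgq
  have hw : ∀ i < q, ∃ c, f (Sum.inl c) = 2 * i + 1 := by
    intro i hi
    obtain ⟨x, hx⟩ := hsurj (2 * i + 1) (by omega)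
    have hp := hparity _ x hx
    rcases x with c | d
    · exact ⟨c, hx⟩
    · simp at hp
  have hCne : Nonempty C := ⟨(hw 0 (by omega)).choose⟩
  choose! w hw using hw
  refine ⟨B, w, hBsurj, hBinj, fun c => ?_, fun i j hi hj => ?_⟩
  · have hc := hint c
    have hp := hparity _ (Sum.inl c) rfl
    simp only [Sum.isRight_inl, Bool.false_eq_true, false_iff, Nat.not_even_iff_odd] at hp
    obtain ⟨i, hi⟩ := hp
    refine ⟨i, by omega, Sum.inl_injective (hf ?_)⟩
    rw [hw i (by omega), hi]
  · rw [hadj, hw i (by omega), hB j hj]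
    omega

end PathTree

section BlockChain

variable {V : Type} {G : SimpleGraph V} {b : ℕ}

theorem exists_parametrization (hb : 3 ≤ b) {B : G.Subgraph} (e : B.coe ≃g zmodCycle b) :
    ∃ c : ZMod b → V, Function.Injective c ∧ Set.range c = B.verts ∧
      ∀ x y, B.Adj (c x) (c y) ↔ x - y = 1 ∨ y - x = 1 := by
  refine ⟨fun x => (e.symm x).1, Subtype.val_injective.comp e.symm.injective, ?_, fun x y => ?_⟩
  · rw [Set.range_comp' Subtype.val, e.symm.surjective.range_eq]
    simp
  · have : Fact (1 < b) := ⟨by omega⟩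
    rw [← Subgraph.coe_adj, e.symm.map_adj_iff, zmodCycle, fromRel_adj, and_iff_right_of_imp]
    rintro h rfl
    simp at h

theorem IsCycleChain.natCast_ne_zero {g k : ℕ} {c : ℕ → ZMod b → V}
    (h : IsCycleChain G g b c (fun _ => 0) (fun _ => (k : ZMod b))) (hg : 3 ≤ g) :
    (k : ZMod b) ≠ 0 := by
  intro hk
  have h0 := h.glue 0 (by omega)
  have h1 := h.glue 1 (by omega)
  rw [hk] at h0 h1
  have := (h.meet 0 2 0 0 (by omega) (by omega) (h0.trans h1)).1
  omega

variable [Fintype V]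

theorem blockCutTree_adj_inl_inr (v : {v : V // IsCutVertex G v})
    (B : {B : G.Subgraph // IsBlock G B}) :
    (blockCutTree G).Adj (Sum.inl v) (Sum.inr B) ↔ v.1 ∈ B.1.verts := by
  simp only [blockCutTree, fromRel_adj]
  constructor
  · rintro ⟨-, ⟨v', B', hv, hB, hmem⟩ | ⟨v', B', hv, hB, hmem⟩⟩
    · obtain rfl := Sum.inl_injective hv
      obtain rfl := Sum.inr_injective hB
      exact hmem
    · cases hv
  · exact fun h => ⟨Sum.inl_ne_inr, Or.inl ⟨v, B, rfl, rfl, h⟩⟩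

theorem not_blockCutTree_adj_inl_inl (v w : {v : V // IsCutVertex G v}) :
    ¬ (blockCutTree G).Adj (Sum.inl v) (Sum.inl w) := by
  simp [blockCutTree]

theorem not_blockCutTree_adj_inr_inr (A B : {B : G.Subgraph // IsBlock G B}) :
    ¬ (blockCutTree G).Adj (Sum.inr A) (Sum.inr B) := by
  simp [blockCutTree]

theorem IsBlock.twoConnected_of_iso (hb : 3 ≤ b) {B : G.Subgraph} (hB : IsBlock G B)
    (e : B.coe ≃g zmodCycle b) : TwoConnected B := by
  refine (kConnected_two_iff B).1 (hB.2.resolve_right ?_)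
  rintro ⟨u, v, -, huv, -⟩
  have hcard : Nat.card B.verts = b := by
    rw [Nat.card_congr e.toEquiv, Nat.card_zmod]
  rw [huv, Nat.card_coe_set_eq] at hcard
  have := Set.ncard_insert_le u {v}
  rw [Set.ncard_singleton] at this
  omega

/-- A connected graph whose blocks are cycles arranged along a path is a chain of cycles, where
cut vertices are exactly the gluing vertices. -/
theorem exists_isCycleChain (hG : G.Connected) {g : ℕ} (hg : 1 < g) (hb : 3 ≤ b)
    (hblocks : Nat.card {B : G.Subgraph // IsBlock G B} = g)
    (hcycle : ∀ B : G.Subgraph, IsBlock G B → Nonempty (B.coe ≃g zmodCycle b))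
    {r : ℕ} (e : blockCutTree G ≃g pathGraph r) :
    ∃ (c : ℕ → ZMod b → V) (a z : ℕ → ZMod b), IsCycleChain G g b c a z ∧
      (∀ i < g, ∃ B, IsBlock G B ∧ Set.range (c i) = B.verts) ∧
      ∀ i, i + 1 < g → IsCutVertex G (c i (z i)) := by
  have htwo : ∀ B, IsBlock G B → TwoConnected B := fun B hB =>
    hB.twoConnected_of_iso hb (hcycle B hB).some
  obtain ⟨B₀, hB₀⟩ : Nonempty {B : G.Subgraph // IsBlock G B} :=
    (Nat.card_pos_iff.1 (hblocks ▸ Nat.zero_lt_of_lt hg)).1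
  have hV : Nontrivial V := by
    obtain ⟨v⟩ := hG.nonempty
    obtain ⟨u, -, huv⟩ := (htwo B₀ hB₀).exists_mem_ne v
    exact ⟨u, v, huv⟩
  obtain ⟨B, w, hBsurj, hBinj, hwsurj, hadj⟩ := exists_enumeration_of_iso_pathGraph e
    not_blockCutTree_adj_inl_inl not_blockCutTree_adj_inr_inr (fun v => by
      obtain ⟨B, hB, hv⟩ := exists_isBlock_mem hG v.1
      obtain ⟨B', hB', hne, hv'⟩ := exists_isBlock_ne_of_isCutVertex hG (htwo B hB) hv v.2
      exact ⟨⟨B, hB⟩, ⟨B', hB'⟩, fun h => hne (congrArg Subtype.val h).symm,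
        (blockCutTree_adj_inl_inr _ _).2 hv, (blockCutTree_adj_inl_inr _ _).2 hv'⟩) hblocks hg
  simp only [blockCutTree_adj_inl_inr] at hadj
  choose c hc hrange hcadj using fun i => exists_parametrization hb (hcycle (B i).1 (B i).2).some
  have hz : ∀ i, ∃ x, i + 1 < g → c i x = (w i).1 := by
    intro i
    by_cases hi : i + 1 < g
    · have : (w i).1 ∈ Set.range (c i) := hrange i ▸ (hadj i i hi (by omega)).2 (Or.inl rfl)
      exact this.imp fun _ h _ => h
    · exact ⟨0, fun h => absurd h hi⟩
  have ha : ∀ i, ∃ x, i + 1 < g → c (i + 1) x = (w i).1 := by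
    intro i
    by_cases hi : i + 1 < g
    · have : (w i).1 ∈ Set.range (c (i + 1)) :=
        hrange (i + 1) ▸ (hadj i (i + 1) hi hi).2 (Or.inr rfl)
      exact this.imp fun _ h _ => h
    · exact ⟨0, fun h => absurd h hi⟩
  choose z hz using hz
  choose a ha using ha
  have hmem : ∀ i x, c i x ∈ (B i).1.verts := fun i x => hrange i ▸ Set.mem_range_self x
  refine ⟨c, fun i => a (i - 1), z, ⟨fun i _ => hc i, ?_, ?_, ?_, ?_⟩,
    fun i _ => ⟨_, (B i).2, hrange i⟩, fun i hi => hz i hi ▸ (w i).2⟩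
  · intro i hi
    rw [hz i hi, Nat.add_sub_cancel, ha i hi]
  · intro i j x y hij hj hxy
    have hne : (B i).1 ≠ (B j).1 := fun h =>
      hij.ne (hBinj i j (hij.trans hj) hj (Subtype.ext h))
    obtain ⟨l, hl, hwl⟩ := hwsurj ⟨c i x, isCutVertex_of_mem_of_mem (B i).2 (B j).2
      (htwo _ (B i).2) (htwo _ (B j).2) hne (hmem i x) (hxy ▸ hmem j y)⟩
    have hwl' : (w l).1 = c i x := congrArg Subtype.val hwl
    have hi' := (hadj l i hl (hij.trans hj)).1 (hwl' ▸ hmem i x)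
    have hj' := (hadj l j hl hj).1 (hwl' ▸ hxy ▸ hmem j y)
    obtain rfl : l = i := by omega
    obtain rfl : j = l + 1 := by omega
    refine ⟨rfl, hc l ?_, hc (l + 1) ?_⟩
    · rw [hz l hl, hwl']
    · rw [Nat.add_sub_cancel, ha l hl, hwl', hxy]
  · intro v
    obtain ⟨A, hA, hv⟩ := exists_isBlock_mem hG v
    obtain ⟨i, hi, hBi⟩ := hBsurj ⟨A, hA⟩
    have : v ∈ Set.range (c i) := by rwa [hrange i, hBi]
    exact ⟨i, hi, this⟩
  · intro v u
    constructor
    · intro h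
      obtain ⟨A, hA, hvu⟩ := exists_isBlock_adj h
      obtain ⟨i, hi, hBi⟩ := hBsurj ⟨A, hA⟩
      have hv : v ∈ Set.range (c i) := by rw [hrange i, hBi]; exact hvu.fst_mem
      have hu : u ∈ Set.range (c i) := by rw [hrange i, hBi]; exact hvu.snd_mem
      obtain ⟨x, rfl⟩ := hv
      obtain ⟨y, rfl⟩ := hu
      exact ⟨i, hi, x, y, rfl, rfl, (hcadj i x y).1 (by rwa [hBi])⟩
    · rintro ⟨i, -, x, y, rfl, rfl, h⟩
      exact ((hcadj i x y).2 h).adj_sub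

end BlockChain

/-- Let `g ≥ 3`, `b ≥ 3`, `k ≥ 1`, and let `G` be a connected graph with exactly `g`
blocks, each a cycle of length `b`, whose block-cut vertex tree is a path, such
that distinct cut vertices sharing a block are at distance exactly `k`.  Then
`gon(G) = min(⌊(g+3)/2⌋, min{t ∈ [b] : tk ≡ 0 (mod b)})`. -/
theorem stmt_13 {V : Type} [Fintype V] (G : SimpleGraph V) (hG : G.Connected)
    (g b k : ℕ) (hg : 3 ≤ g) (hb : 3 ≤ b) (hk : 1 ≤ k)
    (hblocks : Nat.card {B : G.Subgraph // IsBlock G B} = g)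
    (hcycle : ∀ B : G.Subgraph, IsBlock G B → Nonempty (B.coe ≃g zmodCycle b))
    (hpath : ∃ r : ℕ, Nonempty (blockCutTree G ≃g SimpleGraph.pathGraph r))
    (hdist : ∀ v w : V, IsCutVertex G v → IsCutVertex G w → v ≠ w →
      (∃ B : G.Subgraph, IsBlock G B ∧ v ∈ B.verts ∧ w ∈ B.verts) →
      G.dist v w = k) :
    gonality G = min ((g + 3) / 2) (sInf {t : ℕ | 1 ≤ t ∧ t ≤ b ∧ b ∣ t * k}) := by
  obtain ⟨r, ⟨e⟩⟩ := hpath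
  obtain ⟨c, a, z, h, hrange, hcut⟩ :=
    exists_isCycleChain hG (by omega) hb hblocks hcycle e
  obtain ⟨c', h'⟩ := h.exists_normalized (k := k) hG fun i hi hig => by
    obtain ⟨j, rfl⟩ : ∃ j, i = j + 1 := ⟨i - 1, by omega⟩
    have hglue := h.glue j (by omega)
    obtain ⟨B, hB, hBr⟩ := hrange (j + 1) (by omega)
    refine hdist _ _ (hglue ▸ hcut j (by omega)) (hcut _ hig) (fun heq => ?_)
      ⟨B, hB, hBr ▸ Set.mem_range_self _, hBr ▸ Set.mem_range_self _⟩
    have := (h.meet j (j + 1 + 1) _ _ (by omega) hig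
      (hglue.trans (heq.trans (h.glue (j + 1) hig)))).1
    omega
  exact gonality_of_isCycleChain h' hg hb (h'.natCast_ne_zero hg)
end
end

section
/- For every positive integer t_0, there exist connected finite simple graphs G and H such that G is a subgraph of H, gon(G) = t_0 and gon(H) = 3. -/
open SimpleGraph Finset
open scoped Classical

noncomputable section

theorem lap_add {V : Type} [Fintype V] (G : SimpleGraph V) (S T : V → ℤ) (v : V) :
    lap G (S + T) v = lap G S v + lap G T v := by
  simp only [lap, ← Finset.sum_add_distrib, Pi.add_apply]
  refine Finset.sum_congr rfl fun w _ => ?_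
  split_ifs <;> ring

theorem lap_neg {V : Type} [Fintype V] (G : SimpleGraph V) (S : V → ℤ) (v : V) :
    lap G (-S) v = -lap G S v := by
  simp only [lap, ← Finset.sum_neg_distrib, Pi.neg_apply]
  refine Finset.sum_congr rfl fun w _ => ?_
  split_ifs <;> ring

theorem lap_const {V : Type} [Fintype V] (G : SimpleGraph V) (c : ℤ) (v : V) :
    lap G (fun _ => c) v = 0 := by
  simp [lap]

theorem sum_lap {V : Type} [Fintype V] (G : SimpleGraph V) (S : V → ℤ) :
    ∑ v, lap G S v = 0 := by
  have h : ∑ v, lap G S v = -∑ v, lap G S v := by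
    conv_lhs => simp only [lap]
    rw [Finset.sum_comm]
    simp only [lap, ← Finset.sum_neg_distrib]
    refine Finset.sum_congr rfl fun v _ => Finset.sum_congr rfl fun w _ => ?_
    simp only [G.adj_comm w v]
    split_ifs <;> ring
  omega

theorem lap_sup {V : Type} [Fintype V] {G H : SimpleGraph V} (h : Disjoint G H)
    (S : V → ℤ) (v : V) : lap (G ⊔ H) S v = lap G S v + lap H S v := by
  simp only [lap, ← Finset.sum_add_distrib]
  refine Finset.sum_congr rfl fun w _ => ?_
  have hd : ¬ (G.Adj v w ∧ H.Adj v w) := fun hh => by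
    exact (le_iff_adj.1 (disjoint_iff_inf_le.1 h) v w hh).elim
  by_cases hG : G.Adj v w <;> by_cases hH : H.Adj v w <;> simp_all

theorem lap_eq_sum {V : Type} [Fintype V] {G : SimpleGraph V} {v : V} {s : Finset V}
    (hs : ∀ w, G.Adj v w ↔ w ∈ s) (S : V → ℤ) : lap G S v = ∑ w ∈ s, (S v - S w) := by
  simp only [lap, hs, Finset.sum_ite_mem, Finset.univ_inter]

theorem lap_comp_iso {V W : Type} [Fintype V] [Fintype W] {G : SimpleGraph V}
    {H : SimpleGraph W} (e : G ≃g H) (S : W → ℤ) (v : V) :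
    lap G (S ∘ e) v = lap H S (e v) := by
  simp only [lap]
  refine Fintype.sum_equiv e.toEquiv _ _ fun w => ?_
  have h : H.Adj (e v) (e w) ↔ G.Adj v w := e.map_adj_iff
  change _ = if H.Adj (e v) (e w) then S (e v) - S (e w) else 0
  simp only [h, Function.comp_apply]

theorem gonality_le {V : Type} [Fintype V] {G : SimpleGraph V} {D : V → ℤ} {n : ℕ}
    (hD : Effective D) (hr : PosRank G D) (hn : degDiv D = n) : gonality G ≤ n :=
  Nat.sInf_le ⟨D, hD, hr, hn⟩

theorem exists_gonality {V : Type} [Fintype V] (G : SimpleGraph V) :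
    ∃ D : V → ℤ, Effective D ∧ PosRank G D ∧ degDiv D = gonality G := by
  refine Nat.sInf_mem (s := {n : ℕ | ∃ D : V → ℤ, Effective D ∧ PosRank G D ∧ degDiv D = n})
    ⟨Fintype.card V, fun _ => 1, fun _ => zero_le_one, fun v => ⟨fun _ => 1,
      fun _ => zero_le_one, ⟨fun _ => 0, ?_⟩, le_rfl⟩, ?_⟩
  · funext w
    simp [lap_const]
  · simp [degDiv]

theorem gonality_le_of_iso {V W : Type} [Fintype V] [Fintype W] {G : SimpleGraph V}
    {H : SimpleGraph W} (e : G ≃g H) : gonality G ≤ gonality H := by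
  obtain ⟨D, hD, hr, hn⟩ := exists_gonality H
  refine gonality_le (D := D ∘ e) (fun v => hD _) (fun v => ?_) ?_
  · obtain ⟨D', hD', ⟨S, hS⟩, h1⟩ := hr (e v)
    refine ⟨D' ∘ e, fun w => hD' _, ⟨S ∘ e, ?_⟩, h1⟩
    funext w
    simp [lap_comp_iso, hS]
  · rw [← hn]
    exact Fintype.sum_equiv e.toEquiv _ _ fun w => rfl

theorem gonality_congr {V W : Type} [Fintype V] [Fintype W] {G : SimpleGraph V}
    {H : SimpleGraph W} (e : G ≃g H) : gonality G = gonality H :=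
  (gonality_le_of_iso e).antisymm (gonality_le_of_iso e.symm)

theorem LinEquiv.trans {V : Type} [Fintype V] {G : SimpleGraph V} {D E F : V → ℤ}
    (h : LinEquiv G D E) (h' : LinEquiv G E F) : LinEquiv G D F := by
  obtain ⟨S, rfl⟩ := h
  obtain ⟨T, rfl⟩ := h'
  refine ⟨S + T, ?_⟩
  funext v
  simp only [Pi.sub_apply, lap_add]
  ring

/-- Stopping the firing script `-g` at the level of `w` puts a chip on `w`. -/
theorem exists_chip_of_potential {V : Type} [Fintype V] {G : SimpleGraph V} {E g : V → ℤ}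
    (hE : Effective E) (hg : ∀ v, 0 ≤ E v + lap G g v) {w : V}
    (hw : ∃ y, G.Adj w y ∧ g y < g w) :
    ∃ D' : V → ℤ, Effective D' ∧ LinEquiv G E D' ∧ 1 ≤ D' w := by
  set T := g w with hT
  refine ⟨fun v => E v + lap G (fun x => min (g x) T) v, fun v => ?_,
    ⟨-(fun x => min (g x) T), ?_⟩, ?_⟩
  · rcases le_total T (g v) with h | h
    · refine add_nonneg (hE v) (Finset.sum_nonneg fun y _ => ?_)
      dsimp only
      split_ifs <;> omega
    · refine (hg v).trans (add_le_add le_rfl (Finset.sum_le_sum fun y _ => ?_))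
      dsimp only
      split_ifs <;> omega
  · funext v
    simp [lap_neg]
  · obtain ⟨y, hy, hlt⟩ := hw
    have h1 : (1 : ℤ) ≤ lap G (fun x => min (g x) T) w := by
      refine le_trans ?_ (Finset.single_le_sum (f := fun y => if G.Adj w y then
        min (g w) T - min (g y) T else 0) (fun z _ => ?_) (Finset.mem_univ y))
      · simp only [hy, if_true]; omega
      · split_ifs <;> omega
    have := hE w
    dsimp only
    omega

theorem connected_of_descent {V : Type} [Finite V] {G : SimpleGraph V} (g : V → ℤ) (s : V)
    (h : ∀ w, w ≠ s → ∃ y, G.Adj w y ∧ g y < g w) : G.Connected := by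
  have key : ∀ w, G.Reachable w s := by
    have wf : WellFounded (fun x y : V => g x < g y) :=
      @Finite.wellFounded_of_trans_of_irrefl V _ _ ⟨fun _ _ _ => lt_trans⟩ ⟨fun _ => lt_irrefl _⟩
    intro w
    induction w using wf.induction with
    | _ w ih =>
      by_cases hw : w = s
      · rw [hw]
      · obtain ⟨y, hy, hlt⟩ := h w hw
        exact hy.reachable.trans (ih y hlt)
  exact { preconnected := fun x y => (key x).trans (key y).symm, nonempty := ⟨s⟩ }

/-- `k` copies of `B` in a row, with an edge from `v` in each copy to `u` in the next one. -/
def chain (k : ℕ) {β : Type} (B : SimpleGraph β) (u v : β) : SimpleGraph (Fin k × β) where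
  Adj p q := (p.1 = q.1 ∧ B.Adj p.2 q.2) ∨ (p.1.val + 1 = q.1.val ∧ p.2 = v ∧ q.2 = u) ∨
    (q.1.val + 1 = p.1.val ∧ q.2 = v ∧ p.2 = u)
  symm := ⟨fun p q h => by
    rcases h with ⟨h, h'⟩ | h | h
    · exact Or.inl ⟨h.symm, h'.symm⟩
    · exact Or.inr (Or.inr h)
    · exact Or.inr (Or.inl h)⟩
  loopless := ⟨fun p h => by
    rcases h with ⟨_, h⟩ | h | h
    · exact B.loopless.irrefl _ h
    · omega
    · omega⟩

/-- The flow of `S` along the edge from copy `n - 1` to copy `n` of a chain. -/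
def bridgeFlow {k : ℕ} {β : Type} (u v : β) (S : Fin k × β → ℤ) (n : ℕ) : ℤ :=
  if h : 0 < n ∧ n < k then S (⟨n - 1, by omega⟩, v) - S (⟨n, h.2⟩, u) else 0

theorem lap_chain {k : ℕ} {β : Type} [Fintype β] (B : SimpleGraph β) (u v : β)
    (S : Fin k × β → ℤ) (i : Fin k) (x : β) :
    lap (chain k B u v) S (i, x) = lap B (fun y => S (i, y)) x +
      (if x = v then bridgeFlow u v S (i.val + 1) else 0) -
      (if x = u then bridgeFlow u v S i.val else 0) := by
  have split : ∀ j y, (if (chain k B u v).Adj (i, x) (j, y) then S (i, x) - S (j, y) else 0) =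
      (if i = j then (if B.Adj x y then S (i, x) - S (i, y) else 0) else 0) +
      (if y = u then (if i.val + 1 = j.val ∧ x = v then S (i, x) - S (j, y) else 0) else 0) +
      (if y = v then (if j.val + 1 = i.val ∧ x = u then S (i, x) - S (j, y) else 0) else 0) := by
    intro j y
    simp only [chain]
    by_cases h1 : i = j
    · subst h1
      simp
    · by_cases h2 : i.val + 1 = j.val
      · have h3 : ¬ j.val + 1 = i.val := by omega
        by_cases hx : x = v <;> by_cases hy : y = u <;> simp [h1, h2, h3, hx, hy]
      · by_cases h3 : j.val + 1 = i.val
        · by_cases hx : x = u <;> by_cases hy : y = v <;> simp [h1, h2, h3, hx, hy]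
        · simp [h1, h2, h3]
  have fwd : (∑ j : Fin k, if i.val + 1 = j.val ∧ x = v then S (i, x) - S (j, u) else 0) =
      if x = v then bridgeFlow u v S (i.val + 1) else 0 := by
    by_cases hx : x = v
    · subst hx
      by_cases hk : i.val + 1 < k
      · rw [Finset.sum_eq_single ⟨i.val + 1, hk⟩]
        · simp [bridgeFlow, hk]
        · intro j _ hj
          rw [if_neg]
          exact fun h => hj (Fin.ext h.1.symm)
        · simp
      · rw [Finset.sum_eq_zero]
        · simp [bridgeFlow, hk]
        · intro j _
          rw [if_neg]
          exact fun h => by omega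
    · simp [hx]
  have bwd : (∑ j : Fin k, if j.val + 1 = i.val ∧ x = u then S (i, x) - S (j, v) else 0) =
      -if x = u then bridgeFlow u v S i.val else 0 := by
    by_cases hx : x = u
    · subst hx
      by_cases hk : 0 < i.val
      · rw [Finset.sum_eq_single ⟨i.val - 1, by omega⟩]
        · have : i.val - 1 + 1 = i.val := by omega
          simp [bridgeFlow, hk, this]
        · intro j _ hj
          rw [if_neg]
          exact fun h => hj (Fin.ext (by simp only; omega))
        · simp
      · rw [Finset.sum_eq_zero]
        · simp [bridgeFlow, hk]
        · intro j _
          rw [if_neg]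
          exact fun h => by omega
    · simp [hx]
  rw [lap, Fintype.sum_prod_type]
  simp only [split, Finset.sum_add_distrib, Finset.sum_ite_eq', Finset.mem_univ, if_true]
  rw [fwd, bwd, Finset.sum_comm]
  simp only [Finset.sum_ite_eq, Finset.mem_univ, if_true, lap]
  ring

/-- The number of chips of `D` in the first `n` copies of a chain. -/
def prefixDeg {k : ℕ} {β : Type} [Fintype β] (D : Fin k × β → ℤ) (n : ℕ) : ℤ :=
  ∑ i : Fin k, if i.val < n then ∑ x, D (i, x) else 0

theorem prefixDeg_succ {k : ℕ} {β : Type} [Fintype β] (D : Fin k × β → ℤ) (i : Fin k) :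
    prefixDeg D (i.val + 1) = prefixDeg D i.val + ∑ x, D (i, x) := by
  have h : ∑ x, D (i, x) = ∑ j : Fin k, if j = i then ∑ x, D (j, x) else 0 := by simp
  rw [h, prefixDeg, prefixDeg, ← Finset.sum_add_distrib]
  refine Finset.sum_congr rfl fun j _ => ?_
  by_cases h1 : j = i
  · subst h1; simp
  · have : j.val ≠ i.val := fun h => h1 (Fin.ext h)
    by_cases h2 : j.val < i.val
    · simp [h1, h2, Nat.lt_succ_of_lt h2]
    · have h3 : ¬ j.val < i.val + 1 := by omega
      simp [h1, h2, h3]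

theorem prefixDeg_mono {k : ℕ} {β : Type} [Fintype β] {D : Fin k × β → ℤ} (hD : Effective D) :
    Monotone (prefixDeg D) := by
  intro a b hab
  refine Finset.sum_le_sum fun i _ => ?_
  have : 0 ≤ ∑ x, D (i, x) := Finset.sum_nonneg fun x _ => hD _
  split_ifs <;> omega

theorem prefixDeg_zero {k : ℕ} {β : Type} [Fintype β] (D : Fin k × β → ℤ) :
    prefixDeg D 0 = 0 := by
  simp [prefixDeg]

theorem prefixDeg_le {k : ℕ} {β : Type} [Fintype β] {D : Fin k × β → ℤ} (hD : Effective D)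
    (n : ℕ) : prefixDeg D n ≤ degDiv D := by
  rw [degDiv, Fintype.sum_prod_type]
  refine Finset.sum_le_sum fun i _ => ?_
  have : 0 ≤ ∑ x, D (i, x) := Finset.sum_nonneg fun x _ => hD _
  split_ifs <;> omega

theorem prefixDeg_sub_lap {k : ℕ} {β : Type} [Fintype β] (B : SimpleGraph β) (u v : β)
    (D S : Fin k × β → ℤ) (n : ℕ) (hn : n < k) :
    prefixDeg (D - lap (chain k B u v) S) n = prefixDeg D n - bridgeFlow u v S n := by
  induction n with
  | zero => simp [prefixDeg_zero, bridgeFlow]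
  | succ n ih =>
    have h1 := prefixDeg_succ (D - lap (chain k B u v) S) ⟨n, by omega⟩
    have h2 := prefixDeg_succ D ⟨n, by omega⟩
    have ih := ih (by omega)
    simp only [Pi.sub_apply, Finset.sum_sub_distrib, lap_chain, Finset.sum_add_distrib, sum_lap,
      Finset.sum_ite_eq', Finset.mem_univ, if_true] at h1 h2
    linarith

theorem eq_zero_of_sum_eq_zero {β : Type} [Fintype β] {f : β → ℤ} (hf : ∀ x, 0 ≤ f x)
    (h : ∑ x, f x = 0) (x : β) : f x = 0 :=
  (Finset.sum_eq_zero_iff_of_nonneg fun x _ => hf x).1 h x (Finset.mem_univ x)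

theorem exists_step_eq {F : ℕ → ℤ} (hF : Monotone F) {d : ℕ} (p W : ℕ)
    (hd : F (p + (d + 1) * W) ≤ F p + d) : ∃ j ≤ d, F (p + j * W + W) = F (p + j * W) := by
  by_contra! hne
  have h : ∀ j ≤ d + 1, F p + j ≤ F (p + j * W) := by
    intro j
    induction j with
    | zero => simp
    | succ j ih =>
      intro hj
      have h1 := ih (by omega)
      have h2 := hne j (by omega)
      have h3 : F (p + j * W) ≤ F (p + j * W + W) := hF (by omega)
      have h4 : p + (j + 1) * W = p + j * W + W := by ring
      rw [h4]
      push_cast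
      omega
  have := h (d + 1) le_rfl
  push_cast at this
  omega

/-- If a flow of value at most `d` cannot pass through an empty block, then a long chain of
blocks has gonality more than `d`. -/
theorem lt_gonality_chain {β : Type} [Fintype β] {B : SimpleGraph β} {u v : β} (huv : u ≠ v)
    {d : ℕ} (hB : ∀ S : β → ℤ, (∀ x, x ≠ u → x ≠ v → lap B S x = 0) → |lap B S u| ≤ d →
      lap B S u = 0) {k : ℕ} (hk : (d + 1) * (2 * d + 3) ≤ k) :
    d < gonality (chain k B u v) := by
  by_contra! hle
  obtain ⟨D, hD, hr, hn⟩ := exists_gonality (chain k B u v)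
  have hdeg : degDiv D ≤ d := by rw [hn]; exact_mod_cast hle
  obtain ⟨j, hj, hwin⟩ := exists_step_eq (prefixDeg_mono hD) (d := d) 0 (2 * d + 3)
    (by rw [prefixDeg_zero]; linarith [prefixDeg_le hD (0 + (d + 1) * (2 * d + 3))])
  set p := 0 + j * (2 * d + 3)
  have hp : p + (2 * d + 3) ≤ k := by
    have : (j + 1) * (2 * d + 3) ≤ (d + 1) * (2 * d + 3) := Nat.mul_le_mul_right _ (by omega)
    have h2 : (j + 1) * (2 * d + 3) = p + (2 * d + 3) := by simp only [p]; ring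
    omega
  have hconst : ∀ n, p ≤ n → n ≤ p + (2 * d + 3) → prefixDeg D n = prefixDeg D p :=
    fun n h1 h2 => le_antisymm (hwin ▸ prefixDeg_mono hD h2) (prefixDeg_mono hD h1)
  obtain ⟨D', hD', ⟨S, hS⟩, hM⟩ := hr (⟨p + d + 1, by omega⟩, u)
  have hdeg' : degDiv D' = degDiv D := by
    simp only [hS, degDiv, Pi.sub_apply, Finset.sum_sub_distrib, sum_lap, sub_zero]
  have hflow : ∀ n < k, prefixDeg D' n = prefixDeg D n - bridgeFlow u v S n := fun n hn => by
    rw [hS, prefixDeg_sub_lap _ _ _ _ _ _ hn]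
  have hnonneg : ∀ {E : Fin k × β → ℤ}, Effective E → ∀ n, 0 ≤ prefixDeg E n := fun hE n => by
    exact (prefixDeg_zero _).symm.le.trans (prefixDeg_mono hE n.zero_le)
  have hfree : ∀ n, p ≤ n → n < p + (2 * d + 3) → prefixDeg D' (n + 1) = prefixDeg D' n →
      prefixDeg D' n = prefixDeg D p := by
    intro n h1 h2 h3
    have hnk : n < k := by omega
    have e1 := prefixDeg_succ D ⟨n, hnk⟩
    have e2 := prefixDeg_succ D' ⟨n, hnk⟩
    simp only [h3, hconst n h1 h2.le, hconst (n + 1) (by omega) h2] at e1 e2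
    have z1 := eq_zero_of_sum_eq_zero (fun x => hD (⟨n, hnk⟩, x)) (by linarith)
    have z2 := eq_zero_of_sum_eq_zero (fun x => hD' (⟨n, hnk⟩, x)) (by linarith)
    have hlap : ∀ x, lap (chain k B u v) S (⟨n, hnk⟩, x) = 0 := fun x => by
      have := congrFun hS (⟨n, hnk⟩, x)
      rw [Pi.sub_apply, z1, z2] at this
      linarith
    simp only [lap_chain] at hlap
    have hu := hlap u
    simp only [if_neg huv, if_true] at hu
    have hfl := hflow n hnk
    have b1 := prefixDeg_le hD n
    have b2 := prefixDeg_le hD' n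
    have b3 := hnonneg hD n
    have b4 := hnonneg hD' n
    have := hB (fun y => S (⟨n, hnk⟩, y)) (fun x hx hx' => by simpa [hx, hx'] using hlap x)
      (by rw [abs_le]; constructor <;> linarith)
    rw [← hconst n h1 h2.le]
    linarith
  obtain ⟨l, hl, hL⟩ := exists_step_eq (prefixDeg_mono hD') (d := d) p 1
    (by linarith [prefixDeg_le hD' (p + (d + 1) * 1), hnonneg hD' p])
  obtain ⟨r, hr, hR⟩ := exists_step_eq (prefixDeg_mono hD') (d := d) (p + d + 2) 1
    (by linarith [prefixDeg_le hD' (p + d + 2 + (d + 1) * 1), hnonneg hD' (p + d + 2)])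
  have hL' := hfree (p + l * 1) (by omega) (by omega) hL
  have hR' := hfree (p + d + 2 + r * 1) (by omega) (by omega) hR
  have m1 : prefixDeg D' (p + l * 1) ≤ prefixDeg D' (p + d + 1) := prefixDeg_mono hD' (by omega)
  have m2 : prefixDeg D' (p + d + 1 + 1) ≤ prefixDeg D' (p + d + 2 + r * 1) :=
    prefixDeg_mono hD' (by omega)
  have hMs := prefixDeg_succ D' ⟨p + d + 1, by omega⟩
  have := Finset.single_le_sum (f := fun x => D' (⟨p + d + 1, by omega⟩, x)) (fun x _ => hD' _)
    (Finset.mem_univ u)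
  simp only at hMs this
  linarith

theorem gonality_le_of_potential {V : Type} [Fintype V] {G : SimpleGraph V} (g : V → ℤ) (s : V)
    {c : ℕ} (hc : 1 ≤ c) (hs : -c ≤ lap G g s) (hg : ∀ w, w ≠ s → 0 ≤ lap G g w)
    (hw : ∀ w, w ≠ s → ∃ y, G.Adj w y ∧ g y < g w) : gonality G ≤ c := by
  have hE : Effective (fun w => if w = s then (c : ℤ) else 0) := fun w => by
    dsimp only
    split_ifs <;> omega
  refine gonality_le (D := fun w => if w = s then (c : ℤ) else 0) hE (fun w => ?_) ?_
  · by_cases h : w = s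
    · refine ⟨_, hE, ⟨fun _ => 0, ?_⟩, ?_⟩
      · funext x
        simp [lap_const]
      · simpa [h] using hc
    · refine exists_chip_of_potential hE (fun x => ?_) (hw w h)
      by_cases hx : x = s
      · subst hx
        simp only [if_true]
        omega
      · simpa [hx] using hg x hx
  · simp [degDiv]

theorem chain_descent {β : Type} {B : SimpleGraph β} {u v : β} {f : β → ℤ} {k : ℕ} {M : ℤ}
    (hf : ∀ x, x ≠ u → ∃ y, B.Adj x y ∧ f y < f x) (hM : f v - f u < M) (p : Fin (k + 1) × β)
    (hp : p ≠ (0, u)) : ∃ q, (chain (k + 1) B u v).Adj p q ∧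
      (q.1.val : ℤ) * M + f q.2 < (p.1.val : ℤ) * M + f p.2 := by
  obtain ⟨i, x⟩ := p
  by_cases hx : x = u
  · subst hx
    have hi : i ≠ 0 := fun h => hp (by rw [h])
    have hi' : i.val ≠ 0 := fun h => hi (Fin.ext h)
    refine ⟨(⟨i.val - 1, by omega⟩, v), Or.inr (Or.inr ⟨?_, rfl, rfl⟩), ?_⟩
    · simp only
      omega
    · simp only
      push_cast [Nat.one_le_iff_ne_zero.2 hi']
      linarith
  · obtain ⟨y, hy, hlt⟩ := hf x hx
    exact ⟨(i, y), Or.inl ⟨rfl, hy⟩, by simpa using hlt⟩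

theorem chain_connected {β : Type} [Finite β] {B : SimpleGraph β} {u v : β} {f : β → ℤ} {k : ℕ}
    (hf : ∀ x, x ≠ u → ∃ y, B.Adj x y ∧ f y < f x) : (chain (k + 1) B u v).Connected :=
  connected_of_descent _ (0, u) (chain_descent hf (lt_add_one (f v - f u)))

theorem gonality_chain_le {β : Type} [Fintype β] {B : SimpleGraph β} {u v : β} (huv : u ≠ v)
    {f : β → ℤ} {c : ℕ} (hc : 1 ≤ c) (hu : lap B f u = -c) (hv : lap B f v = c)
    (h0 : ∀ x, x ≠ u → x ≠ v → lap B f x = 0)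
    (hf : ∀ x, x ≠ u → ∃ y, B.Adj x y ∧ f y < f x) (k : ℕ) :
    gonality (chain (k + 1) B u v) ≤ c := by
  have hM : f v - f u < f v - f u + c := by omega
  have hflow : ∀ n, bridgeFlow (k := k + 1) u v
      (fun p => (p.1.val : ℤ) * (f v - f u + c) + f p.2) n =
        if 0 < n ∧ n < k + 1 then -(c : ℤ) else 0 := by
    intro n
    by_cases h : 0 < n ∧ n < k + 1
    · simp only [bridgeFlow, h, and_self, dite_true, if_true]
      push_cast [Nat.succ_le_of_lt h.1]
      ring
    · simp only [bridgeFlow, h, dite_false, if_false]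
  have hlap : ∀ (i : Fin (k + 1)) x,
      lap B (fun y => (i.val : ℤ) * (f v - f u + c) + f y) x = lap B f x := fun i x => by
    simp [lap]
  refine gonality_le_of_potential _ (0, u) hc ?_ (fun p hp => ?_) (chain_descent hf hM)
  · rw [lap_chain, hlap, hu]
    simp [huv, hflow]
  · obtain ⟨i, x⟩ := p
    rw [lap_chain, hlap, hflow, hflow]
    by_cases hxu : x = u
    · subst hxu
      have hi : i ≠ 0 := fun h => hp (by rw [h])
      have hi' : i.val ≠ 0 := fun h => hi (Fin.ext h)
      have h1 : 0 < i.val ∧ i.val < k + 1 := ⟨by omega, i.isLt⟩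
      simp [huv, hu, h1]
    · by_cases hxv : x = v
      · subst hxv
        simp only [hv, hxu, if_true, if_false]
        split_ifs <;> omega
      · simp [h0 x hxu hxv, hxu, hxv]

/-- Extension of a function on a chain to one more copy of the block. -/
def extendChain {k : ℕ} {β : Type} (S : Fin (k + 1) × β → ℤ) (t : β → ℤ) :
    Fin (k + 2) × β → ℤ :=
  fun p => if h : p.1.val < k + 1 then S (⟨p.1.val, h⟩, p.2) else t p.2

theorem extendChain_castSucc {k : ℕ} {β : Type} (S : Fin (k + 1) × β → ℤ) (t : β → ℤ)
    (i : Fin (k + 1)) (x : β) : extendChain S t (i.castSucc, x) = S (i, x) :=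
  dif_pos i.isLt

theorem extendChain_last {k : ℕ} {β : Type} (S : Fin (k + 1) × β → ℤ) (t : β → ℤ) (x : β) :
    extendChain S t (Fin.last (k + 1), x) = t x := by
  simp [extendChain]

theorem bridgeFlow_extendChain {k : ℕ} {β : Type} (u v : β) (S : Fin (k + 1) × β → ℤ)
    (t : β → ℤ) (n : ℕ) : bridgeFlow u v (extendChain S t) n =
      if n = k + 1 then S (Fin.last k, v) - t u else bridgeFlow u v S n := by
  by_cases h : n = k + 1
  · subst h
    simp [bridgeFlow, extendChain, Fin.last]
  · by_cases h' : 0 < n ∧ n < k + 1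
    · have h1 : 0 < n ∧ n < k + 2 := by omega
      have h2 : n - 1 < k + 1 := by omega
      simp [bridgeFlow, extendChain, h, h', h1, h2]
    · have h1 : ¬ (0 < n ∧ n < k + 2) := by omega
      simp only [bridgeFlow, h, h', h1, dite_false, if_false]

theorem lap_extendChain_castSucc {k : ℕ} {β : Type} [Fintype β] (B : SimpleGraph β) (u v : β)
    (S : Fin (k + 1) × β → ℤ) (t : β → ℤ) (i : Fin (k + 1)) (x : β) :
    lap (chain (k + 2) B u v) (extendChain S t) (i.castSucc, x) =
      lap (chain (k + 1) B u v) S (i, x) +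
        if (i, x) = (Fin.last k, v) then S (Fin.last k, v) - t u else 0 := by
  have hi := i.isLt
  have h1 : i.val ≠ k + 1 := by omega
  rw [lap_chain, lap_chain]
  simp only [extendChain_castSucc, bridgeFlow_extendChain, Fin.val_castSucc, h1, if_false]
  by_cases hl : i = Fin.last k
  · subst hl
    by_cases hx : x = v
    · simp only [hx, Fin.val_last, if_true, bridgeFlow]
      simp
      ring
    · simp [hx]
  · have : i.val + 1 ≠ k + 1 := fun h => hl (Fin.ext (by simp; omega))
    simp only [this, if_false, Prod.mk.injEq, hl, false_and, add_zero]

theorem lap_extendChain_last {k : ℕ} {β : Type} [Fintype β] (B : SimpleGraph β) (u v : β)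
    (S : Fin (k + 1) × β → ℤ) (t : β → ℤ) (x : β) :
    lap (chain (k + 2) B u v) (extendChain S t) (Fin.last (k + 1), x) =
      lap B t x - if x = u then S (Fin.last k, v) - t u else 0 := by
  rw [lap_chain]
  simp only [extendChain_last, bridgeFlow_extendChain, Fin.val_last, if_true]
  simp [bridgeFlow]

/-- Adding a block in which two chips at `u` have positive rank raises the gonality of a chain by
at most one. -/
theorem gonality_chain_succ_le {β : Type} [Fintype β] {B : SimpleGraph β} {u v : β} {f : β → ℤ}
    (hfu : f u = 0) (hu : -2 ≤ lap B f u) (h0 : ∀ x, x ≠ u → 0 ≤ lap B f x)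
    (hf : ∀ x, x ≠ u → ∃ y, B.Adj x y ∧ f y < f x) (k : ℕ) :
    gonality (chain (k + 2) B u v) ≤ gonality (chain (k + 1) B u v) + 1 := by
  obtain ⟨D, hD, hr, hn⟩ := exists_gonality (chain (k + 1) B u v)
  let δ : β → ℤ := fun x => if x = u then 1 else 0
  have heff : ∀ {E : Fin (k + 1) × β → ℤ}, Effective E → Effective (extendChain E δ) := by
    rintro E hE ⟨i, x⟩
    induction i using Fin.lastCases with
    | last =>
      rw [extendChain_last]
      simp only [δ]
      split_ifs <;> omega
    | cast i => rw [extendChain_castSucc]; exact hE _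
  have hequiv : ∀ {E : Fin (k + 1) × β → ℤ}, LinEquiv (chain (k + 1) B u v) D E →
      LinEquiv (chain (k + 2) B u v) (extendChain D δ) (extendChain E δ) := by
    rintro E ⟨S, rfl⟩
    refine ⟨extendChain S fun _ => S (Fin.last k, v), ?_⟩
    funext ⟨i, x⟩
    induction i using Fin.lastCases with
    | last => simp [extendChain_last, lap_extendChain_last, lap_const]
    | cast i => simp [extendChain_castSucc, lap_extendChain_castSucc]
  refine gonality_le (heff hD) ?_ (?_ : _ = _)
  · rintro ⟨i, x⟩
    induction i using Fin.lastCases with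
    | cast i =>
      obtain ⟨E, hE, hDE, h1⟩ := hr (i, x)
      exact ⟨_, heff hE, hequiv hDE, by rwa [extendChain_castSucc]⟩
    | last =>
      obtain ⟨E, hE, hDE, h1⟩ := hr (Fin.last k, v)
      obtain ⟨F, hF, hEF, hx⟩ := exists_chip_of_potential (G := chain (k + 2) B u v)
        (g := extendChain (fun _ => -1) f) (w := (Fin.last (k + 1), x)) (heff hE) (by
          rintro ⟨i, y⟩
          induction i using Fin.lastCases with
          | last =>
            rw [extendChain_last, lap_extendChain_last, hfu]
            by_cases hy : y = u
            · subst hy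
              simp only [δ, if_true]
              linarith
            · simpa [δ, hy] using h0 y hy
          | cast i =>
            rw [extendChain_castSucc, lap_extendChain_castSucc, lap_const, hfu]
            have := hE (i, y)
            by_cases hy : (i, y) = (Fin.last k, v)
            · simp only [hy, if_true]
              linarith
            · simpa only [hy, if_false, add_zero] using this) (by
          by_cases hx : x = u
          · refine ⟨((Fin.last k).castSucc, v), Or.inr (Or.inr ⟨by simp, rfl, hx⟩), ?_⟩
            rw [extendChain_last, extendChain_castSucc, hx, hfu]
            norm_num
          · obtain ⟨y, hy, hlt⟩ := hf x hx
            refine ⟨(Fin.last (k + 1), y), Or.inl ⟨rfl, hy⟩, ?_⟩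
            rwa [extendChain_last, extendChain_last])
      exact ⟨F, hF, (hequiv hDE).trans hEF, hx⟩
  · push_cast
    rw [← hn, degDiv, degDiv, Fintype.sum_prod_type, Fintype.sum_prod_type, Fin.sum_univ_castSucc]
    simp [extendChain_castSucc, extendChain_last, δ]

theorem gonality_chain_one_le {β : Type} [Fintype β] {B : SimpleGraph β} {u v : β} {f : β → ℤ}
    (hu : -2 ≤ lap B f u) (h0 : ∀ x, x ≠ u → 0 ≤ lap B f x)
    (hf : ∀ x, x ≠ u → ∃ y, B.Adj x y ∧ f y < f x) : gonality (chain 1 B u v) ≤ 2 := by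
  have hflow : ∀ (S : Fin 1 × β → ℤ) n, bridgeFlow u v S n = 0 := fun S n => by
    rw [bridgeFlow, dif_neg (by omega)]
  refine gonality_le_of_potential (fun p => f p.2) (0, u) one_le_two ?_ ?_ ?_
  · simpa [lap_chain, hflow] using hu
  · rintro ⟨i, x⟩ hp
    have hx : x ≠ u := fun h => hp (Prod.ext (Subsingleton.elim _ _) h)
    simpa [lap_chain, hflow] using h0 x hx
  · rintro ⟨i, x⟩ hp
    obtain ⟨y, hy, hlt⟩ := hf x fun h => hp (Prod.ext (Subsingleton.elim _ _) h)
    exact ⟨(i, y), Or.inl ⟨rfl, hy⟩, hlt⟩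

/-- The cycle `0, 1, …, m - 1`, for `m ≥ 3`. -/
def cycle (m : ℕ) : SimpleGraph (Fin m) where
  Adj i j := i ≠ j ∧ (i.val + 1 = j.val ∨ j.val + 1 = i.val ∨ (i.val = 0 ∧ j.val + 1 = m) ∨
    (j.val = 0 ∧ i.val + 1 = m))
  symm := ⟨fun i j h => ⟨h.1.symm, by omega⟩⟩
  loopless := ⟨fun _ h => h.1 rfl⟩

theorem lap_cycle {m : ℕ} (hm : 3 ≤ m) {f : ℕ → ℤ} (hf : f m = f 0) (i : Fin m) :
    lap (cycle m) (fun j => f j.val) i = if i.val = 0 then 2 * f 0 - f 1 - f (m - 1) else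
      2 * f i.val - f (i.val + 1) - f (i.val - 1) := by
  have hi := i.isLt
  have key : ∀ a b : Fin m, a ≠ b → (∀ w, (cycle m).Adj i w ↔ w = a ∨ w = b) →
      lap (cycle m) (fun j => f j.val) i = 2 * f i.val - f a.val - f b.val := by
    intro a b hab h
    rw [lap_eq_sum (s := {a, b}) (by simpa using h), Finset.sum_pair hab]
    ring
  by_cases h0 : i.val = 0
  · rw [key ⟨1, by omega⟩ ⟨m - 1, by omega⟩ (by simp only [ne_eq, Fin.mk.injEq]; omega)
      fun w => by simp only [cycle, ne_eq, Fin.ext_iff]; omega, if_pos h0, h0]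
  · rw [if_neg h0]
    by_cases hl : i.val + 1 = m
    · rw [key ⟨0, by omega⟩ ⟨i.val - 1, by omega⟩ (by simp only [ne_eq, Fin.mk.injEq]; omega)
        fun w => by simp only [cycle, ne_eq, Fin.ext_iff]; omega, hl, hf]
    · rw [key ⟨i.val + 1, by omega⟩ ⟨i.val - 1, by omega⟩
        (by simp only [ne_eq, Fin.mk.injEq]; omega)
        fun w => by simp only [cycle, ne_eq, Fin.ext_iff]; omega]

theorem exists_periodic_lift {m : ℕ} (hm : 0 < m) (S : Fin m → ℤ) :
    ∃ f : ℕ → ℤ, f m = f 0 ∧ S = fun j => f j.val :=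
  ⟨fun n => S ⟨n % m, Nat.mod_lt _ hm⟩, by simp, by
    funext j
    simp [Nat.mod_eq_of_lt j.isLt]⟩

theorem eq_affine_of_harmonic {f : ℕ → ℤ} {s e : ℕ}
    (h : ∀ i, s < i → i < e → 2 * f i - f (i + 1) - f (i - 1) = 0) (j : ℕ) (hj : s + j ≤ e) :
    f (s + j) = f s + j * (f (s + 1) - f s) := by
  induction j using Nat.twoStepInduction with
  | zero => simp
  | one => simp
  | more j ih1 ih2 =>
    have h1 := ih1 (by omega)
    have h2 := ih2 (by omega)
    have h3 := h (s + (j + 1)) (by omega) (by omega)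
    have e1 : s + (j + 1) + 1 = s + (j + 2) := by omega
    have e2 : s + (j + 1) - 1 = s + j := by omega
    rw [e1, e2] at h3
    push_cast at *
    linarith

theorem lap_edge {V : Type} [Fintype V] {s t : V} (hst : s ≠ t) (S : V → ℤ) (x : V) :
    lap (edge s t) S x = if x = s then S s - S t else if x = t then S t - S s else 0 := by
  by_cases hs : x = s
  · subst hs
    rw [lap_eq_sum (s := {t}) fun w => by simp only [edge_adj, Finset.mem_singleton]; grind]
    simp
  · by_cases ht : x = t
    · subst ht
      rw [lap_eq_sum (s := {s}) fun w => by simp only [edge_adj, Finset.mem_singleton]; grind]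
      simp [hs]
    · rw [lap_eq_sum (s := ∅) fun w => by simp only [edge_adj, Finset.notMem_empty]; grind]
      simp [hs, ht]

theorem cycle_distance_descent {m : ℕ} (x : Fin m) (hx : x.val ≠ 0) :
    ∃ y, (cycle m).Adj x y ∧ min (y.val : ℤ) (m - y.val) < min (x.val : ℤ) (m - x.val) := by
  have hlt := x.isLt
  by_cases h : 2 * x.val ≤ m
  · refine ⟨⟨x.val - 1, by omega⟩, ?_, ?_⟩
    · simp only [cycle, ne_eq, Fin.ext_iff]
      omega
    · simp only
      omega
  · by_cases hl : x.val + 1 = m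
    · refine ⟨⟨0, by omega⟩, ⟨by simp only [ne_eq, Fin.ext_iff]; omega,
        Or.inr (Or.inr (Or.inr ⟨rfl, hl⟩))⟩, ?_⟩
      simp only
      omega
    · refine ⟨⟨x.val + 1, by omega⟩, ⟨by simp only [ne_eq, Fin.ext_iff]; omega, Or.inl rfl⟩, ?_⟩
      simp only
      omega

theorem lap_cycle_distance {m : ℕ} (hm : 3 ≤ m) (x : Fin m) :
    (if x.val = 0 then -2 else 0 : ℤ) ≤
      lap (cycle m) (fun y => min (y.val : ℤ) (m - y.val)) x := by
  have := lap_cycle hm (f := fun n => min (n : ℤ) (m - n)) (by simp) x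
  rw [this]
  have hx := x.isLt
  split_ifs <;> omega

/-- If the two arcs between `u` and `v` have lengths `p` and `p + 1`, every flow from `u` to `v`
in the cycle is a multiple of `2 * p + 1`. -/
theorem cycle_flow_eq_zero {p : ℕ} (hp : 1 ≤ p) {u v : Fin (2 * p + 1)} (hu : u.val = 0)
    (hv : v.val = p) {d : ℕ} (hd : d < 2 * p + 1) (S : Fin (2 * p + 1) → ℤ)
    (hS : ∀ x, x ≠ u → x ≠ v → lap (cycle (2 * p + 1)) S x = 0)
    (hle : |lap (cycle (2 * p + 1)) S u| ≤ d) : lap (cycle (2 * p + 1)) S u = 0 := by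
  obtain ⟨f, hf, rfl⟩ := exists_periodic_lift (by omega) S
  have hlap := lap_cycle (by omega) hf
  have hharm : ∀ i, 0 < i → i ≠ p → i < 2 * p + 1 → 2 * f i - f (i + 1) - f (i - 1) = 0 := by
    intro i h0 hip hi
    rw [← hS ⟨i, hi⟩ (by simp only [ne_eq, Fin.ext_iff]; omega)
      (by simp only [ne_eq, Fin.ext_iff]; omega), hlap, if_neg (by simp only; omega)]
  have h1 := eq_affine_of_harmonic (s := 0) (e := p)
    (fun i h h' => hharm i h (by omega) (by omega)) p (by omega)
  have haff := eq_affine_of_harmonic (s := p) (e := 2 * p + 1)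
    (fun i h h' => hharm i (by omega) (by omega) h')
  have h2 := haff (p + 1) (by omega)
  have h3 := haff p (by omega)
  have e1 : p + (p + 1) = 2 * p + 1 := by omega
  have e2 : p + p = 2 * p + 1 - 1 := by omega
  rw [e1, hf] at h2
  rw [e2] at h3
  simp only [zero_add] at h1
  have hl := hlap u
  rw [if_pos hu] at hl
  rw [hl] at hle ⊢
  push_cast at h2
  set α := f 1 - f 0 with hα
  set β := f (p + 1) - f p with hβ
  have hdvd : (2 * p + 1 : ℤ) ∣ 2 * f 0 - f 1 - f (2 * p + 1 - 1) := by
    clear_value α β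
    refine ⟨-(α + β), ?_⟩
    linear_combination hα - h3 - 2 * h1 - h2
  refine Int.eq_zero_of_abs_lt_dvd hdvd (lt_of_le_of_lt hle ?_)
  exact_mod_cast hd

/-- A cycle of length `6 * b + 11` with a chord. From `0` to `3 * b + 5` the arcs have lengths
`3 * b + 5` and `3 * b + 6`; the chord joins an inner vertex of one to an inner vertex of the
other. -/
def chordedCycle (b : ℕ) : SimpleGraph (Fin (6 * b + 11)) :=
  cycle (6 * b + 11) ⊔ edge ⟨2 * b + 3, by omega⟩ ⟨5 * b + 10, by omega⟩

/-- The potential of a flow of value three through the chorded cycle. -/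
def chordedPotential (b i : ℕ) : ℤ :=
  if i ≤ 2 * b + 3 then i else if i ≤ 3 * b + 5 then 2 * i - 2 * b - 3
  else if i ≤ 5 * b + 10 then 7 * b + 12 - i else 2 * (6 * b + 11 - i)

theorem lap_chordedCycle (b : ℕ) {f : ℕ → ℤ} (hf : f (6 * b + 11) = f 0)
    (i : Fin (6 * b + 11)) : lap (chordedCycle b) (fun j => f j.val) i =
      (if i.val = 0 then 2 * f 0 - f 1 - f (6 * b + 10) else
        2 * f i.val - f (i.val + 1) - f (i.val - 1)) +
      (if i.val = 2 * b + 3 then f (2 * b + 3) - f (5 * b + 10) else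
        if i.val = 5 * b + 10 then f (5 * b + 10) - f (2 * b + 3) else 0) := by
  have hdisj : Disjoint (cycle (6 * b + 11))
      (edge ⟨2 * b + 3, by omega⟩ ⟨5 * b + 10, by omega⟩) := by
    rw [disjoint_iff_inf_le, le_iff_adj]
    rintro v w ⟨⟨_, h1⟩, h2⟩
    rw [edge_adj] at h2
    simp only [Fin.ext_iff] at h2
    omega
  rw [chordedCycle, lap_sup hdisj, lap_cycle (by omega) hf,
    lap_edge (by simp only [ne_eq, Fin.mk.injEq]; omega)]
  simp only [Fin.ext_iff]
  rfl

theorem chordedPotential_first {b i : ℕ} (h : i ≤ 2 * b + 3) : chordedPotential b i = i :=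
  if_pos h

theorem chordedPotential_second {b i : ℕ} (h : 2 * b + 3 ≤ i) (h' : i ≤ 3 * b + 5) :
    chordedPotential b i = 2 * i - 2 * b - 3 := by
  simp only [chordedPotential]
  split_ifs <;> omega

theorem chordedPotential_third {b i : ℕ} (h : 3 * b + 5 ≤ i) (h' : i ≤ 5 * b + 10) :
    chordedPotential b i = 7 * b + 12 - i := by
  simp only [chordedPotential]
  split_ifs <;> omega

theorem chordedPotential_fourth {b i : ℕ} (h : 5 * b + 10 ≤ i) :
    chordedPotential b i = 2 * (6 * b + 11 - i) := by
  simp only [chordedPotential]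
  split_ifs <;> omega

theorem chordedPotential_periodic (b : ℕ) :
    chordedPotential b (6 * b + 11) = chordedPotential b 0 := by
  rw [chordedPotential_fourth (by omega), chordedPotential_first (by omega)]
  push_cast
  ring

theorem lap_chordedPotential (b : ℕ) (i : Fin (6 * b + 11)) :
    lap (chordedCycle b) (fun j => chordedPotential b j.val) i =
      if i.val = 0 then -3 else if i.val = 3 * b + 5 then 3 else 0 := by
  have hi := i.isLt
  rw [lap_chordedCycle b (chordedPotential_periodic b)]
  generalize i.val = n at *
  by_cases h0 : n = 0
  · rw [if_pos h0, if_pos h0, if_neg (by omega), if_neg (by omega),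
      chordedPotential_first (by omega), chordedPotential_first (by omega),
      chordedPotential_fourth (by omega)]
    push_cast
    ring
  rw [if_neg h0, if_neg h0]
  by_cases hx : n = 2 * b + 3
  · rw [if_pos hx, if_neg (by omega), hx, chordedPotential_first (by omega),
      chordedPotential_second (by omega) (by omega), chordedPotential_first (by omega),
      chordedPotential_fourth (by omega)]
    push_cast
    omega
  rw [if_neg hx]
  by_cases hy : n = 5 * b + 10
  · rw [if_pos hy, if_neg (by omega), hy, chordedPotential_fourth (by omega),
      chordedPotential_fourth (by omega), chordedPotential_third (by omega) (by omega),
      chordedPotential_first (by omega)]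
    push_cast
    omega
  rw [if_neg hy]
  by_cases hv : n = 3 * b + 5
  · rw [if_pos hv, hv, chordedPotential_second (by omega) (by omega),
      chordedPotential_third (by omega) (by omega),
      chordedPotential_second (by omega) (by omega)]
    push_cast
    omega
  rw [if_neg hv]
  rcases lt_or_gt_of_ne hx with h | h
  · rw [chordedPotential_first h.le, chordedPotential_first h, chordedPotential_first (by omega)]
    omega
  rcases lt_or_gt_of_ne hv with h' | h'
  · rw [chordedPotential_second h.le h'.le, chordedPotential_second (by omega) h',
      chordedPotential_second (by omega) (by omega)]
    omega
  rcases lt_or_gt_of_ne hy with h'' | h''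
  · rw [chordedPotential_third h'.le h''.le, chordedPotential_third (by omega) h'',
      chordedPotential_third (by omega) (by omega)]
    omega
  · rw [chordedPotential_fourth h''.le, chordedPotential_fourth (by omega),
      chordedPotential_fourth (by omega)]
    omega

theorem chordedPotential_descent (b : ℕ) (x : Fin (6 * b + 11)) (hx : x.val ≠ 0) :
    ∃ y, (chordedCycle b).Adj x y ∧
      chordedPotential b y.val < chordedPotential b x.val := by
  have hlt := x.isLt
  by_cases h : x.val ≤ 3 * b + 5
  · refine ⟨⟨x.val - 1, by omega⟩, Or.inl ?_, ?_⟩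
    · simp only [cycle, ne_eq, Fin.ext_iff]
      omega
    · simp only [chordedPotential]
      split_ifs <;> omega
  · by_cases hl : x.val + 1 = 6 * b + 11
    · refine ⟨⟨0, by omega⟩, Or.inl ⟨by simp only [ne_eq, Fin.ext_iff]; omega,
        Or.inr (Or.inr (Or.inr ⟨rfl, hl⟩))⟩, ?_⟩
      simp only [chordedPotential]
      split_ifs <;> omega
    · refine ⟨⟨x.val + 1, by omega⟩, Or.inl ⟨by simp only [ne_eq, Fin.ext_iff]; omega,
        Or.inl rfl⟩, ?_⟩
      simp only [chordedPotential]
      split_ifs <;> omega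

theorem chordedCycle_flow_eq_zero (b : ℕ) {u v : Fin (6 * b + 11)} (hu : u.val = 0)
    (hv : v.val = 3 * b + 5) (S : Fin (6 * b + 11) → ℤ)
    (hS : ∀ x, x ≠ u → x ≠ v → lap (chordedCycle b) S x = 0)
    (hle : |lap (chordedCycle b) S u| ≤ (2 : ℕ)) : lap (chordedCycle b) S u = 0 := by
  obtain ⟨f, hf, rfl⟩ := exists_periodic_lift (by omega) S
  have hlap := lap_chordedCycle b hf
  have hzero : ∀ i, 0 < i → i ≠ 3 * b + 5 → i < 6 * b + 11 →
      2 * f i - f (i + 1) - f (i - 1) +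
      (if i = 2 * b + 3 then f (2 * b + 3) - f (5 * b + 10) else
        if i = 5 * b + 10 then f (5 * b + 10) - f (2 * b + 3) else 0) = 0 := by
    intro i h0 hip hi
    have := hS ⟨i, hi⟩ (by simp only [ne_eq, Fin.ext_iff]; omega)
      (by simp only [ne_eq, Fin.ext_iff]; omega)
    rw [hlap] at this
    simp only at this
    rwa [if_neg (by omega : ¬ i = 0)] at this
  have hharm : ∀ i, 0 < i → i ≠ 3 * b + 5 → i ≠ 2 * b + 3 → i ≠ 5 * b + 10 → i < 6 * b + 11 →
      2 * f i - f (i + 1) - f (i - 1) = 0 := by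
    intro i h0 hip hx hy hi
    have := hzero i h0 hip hi
    rwa [if_neg hx, if_neg hy, add_zero] at this
  have aff1 := eq_affine_of_harmonic (f := f) (s := 0) (e := 2 * b + 3)
    (fun i h h' => hharm i (by omega) (by omega) (by omega) (by omega) (by omega))
  have aff2 := eq_affine_of_harmonic (f := f) (s := 2 * b + 3) (e := 3 * b + 5)
    (fun i h h' => hharm i (by omega) (by omega) (by omega) (by omega) (by omega))
  have aff3 := eq_affine_of_harmonic (f := f) (s := 3 * b + 5) (e := 5 * b + 10)
    (fun i h h' => hharm i (by omega) (by omega) (by omega) (by omega) (by omega))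
  have aff4 := eq_affine_of_harmonic (f := f) (s := 5 * b + 10) (e := 6 * b + 11)
    (fun i h h' => hharm i (by omega) (by omega) (by omega) (by omega) (by omega))
  have p1 := aff1 (2 * b + 3) (by omega)
  have q1 := aff1 (2 * b + 2) (by omega)
  have p2 := aff2 (b + 2) (by omega)
  have p3 := aff3 (2 * b + 5) (by omega)
  have q3 := aff3 (2 * b + 4) (by omega)
  have p4 := aff4 (b + 1) (by omega)
  have q4 := aff4 b (by omega)
  have kx := hzero (2 * b + 3) (by omega) (by omega) (by omega)
  have ky := hzero (5 * b + 10) (by omega) (by omega) (by omega)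
  rw [if_pos rfl, show 2 * b + 3 - 1 = 2 * b + 2 by omega] at kx
  rw [if_neg (by omega), if_pos rfl, show 5 * b + 10 - 1 = 5 * b + 9 by omega] at ky
  have hl := hlap u
  rw [if_pos hu, if_neg (by omega), if_neg (by omega), add_zero] at hl
  rw [hl] at hle ⊢
  have e2 : 2 * b + 3 + (b + 2) = 3 * b + 5 := by omega
  have e3 : 3 * b + 5 + (2 * b + 5) = 5 * b + 10 := by omega
  have e3' : 3 * b + 5 + (2 * b + 4) = 5 * b + 9 := by omega
  have e4 : 5 * b + 10 + (b + 1) = 6 * b + 11 := by omega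
  have e4' : 5 * b + 10 + b = 6 * b + 10 := by omega
  rw [e2] at p2
  rw [e3] at p3
  rw [e3'] at q3
  rw [e4, hf] at p4
  rw [e4'] at q4
  simp only [zero_add] at p1 q1
  push_cast at p1 q1 p2 p3 q3 p4 q4
  generalize f (6 * b + 10) = fl at *
  generalize f (2 * b + 2) = fx' at *
  generalize f (2 * b + 3 + 1) = fx'' at *
  generalize f (5 * b + 9) = fy' at *
  generalize f (5 * b + 10 + 1) = fy'' at *
  generalize f (2 * b + 3) = fx at *
  generalize f (5 * b + 10) = fy at *
  generalize f (3 * b + 5 + 1) = fv' at *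
  generalize f (3 * b + 5) = fv at *
  obtain ⟨α, hα⟩ : ∃ α, α = f 1 - f 0 := ⟨_, rfl⟩
  obtain ⟨β, hβ⟩ : ∃ β, β = fy - fy'' := ⟨_, rfl⟩
  rw [← hα] at p1 q1
  have hβ' : fy'' - fy = -β := by linarith
  rw [hβ'] at p4 q4
  have hflow : 2 * f 0 - f 1 - fl = -(α + β) := by linarith
  have hx : fx'' - fx = α + (fx - fy) := by linarith
  have hy : fv' - fv = -(β - (fx - fy)) := by linarith
  have hxy : fx - fy = (2 * b + 3) * α - (b + 1) * β := by linarith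
  rw [hx, hxy] at p2
  rw [hy, hxy] at p3
  have hfac : (3 * (b : ℤ) ^ 2 + 13 * b + 13) * (β - 2 * α) = 0 := by
    linear_combination p2 + p3 + hxy
  have hβα : β = 2 * α := by
    rcases mul_eq_zero.1 hfac with h | h
    · have : (0 : ℤ) < 3 * (b : ℤ) ^ 2 + 13 * b + 13 := by positivity
      omega
    · omega
  rw [hflow] at hle ⊢
  rw [abs_le] at hle
  push_cast at hle
  omega

/-- A chain of `k` blocks is contained in a longer chain of larger blocks. -/
def chainCopy {β : Type} {A B : SimpleGraph β} (hAB : A ≤ B) (u v : β) {k n : ℕ} (hkn : k ≤ n) :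
    Copy (chain k A u v) (chain n B u v) where
  toHom :=
    { toFun := fun p => (Fin.castLE hkn p.1, p.2)
      map_rel' := fun {p q} h => by
        rcases h with ⟨h, h'⟩ | h | h
        · exact Or.inl ⟨by simp only [h], hAB h'⟩
        · exact Or.inr (Or.inl h)
        · exact Or.inr (Or.inr h) }
  injective' := fun p q h => by
    simp only [RelHom.coeFn_mk, Prod.mk.injEq] at h
    exact Prod.ext (Fin.castLE_injective hkn h.1) h.2

theorem gonality_of_subsingleton {V : Type} [Fintype V] [Subsingleton V] (v : V)
    (G : SimpleGraph V) : gonality G = 1 := by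
  have hlap : ∀ S : V → ℤ, lap G S = 0 := fun S => by
    funext w
    simp [lap, Subsingleton.elim _ w]
  have huniv : (Finset.univ : Finset V) = {v} := by
    ext w
    simp [Subsingleton.elim w v]
  refine le_antisymm (gonality_le (D := fun _ => 1) (fun _ => zero_le_one)
    (fun w => ⟨fun _ => 1, fun _ => zero_le_one, ⟨fun _ => 0, ?_⟩, le_rfl⟩) ?_) ?_
  · rw [hlap, sub_zero]
  · simp [degDiv, huniv]
  · obtain ⟨D, hD, hr, hn⟩ := exists_gonality G
    obtain ⟨D', -, ⟨S, hS⟩, h1⟩ := hr v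
    rw [hlap, sub_zero] at hS
    rw [degDiv, huniv, Finset.sum_singleton, ← hS] at hn
    omega

theorem exists_fin_subgraph {V W : Type} [Fintype V] [Fintype W] {A : SimpleGraph W}
    {H : SimpleGraph V} (hH : H.Connected) (hA : A.Connected) (f : Copy A H) :
    ∃ (n : ℕ) (H' : SimpleGraph (Fin n)) (G : H'.Subgraph), H'.Connected ∧ G.coe.Connected ∧
      gonality G.coe = gonality A ∧ gonality H' = gonality H := by
  let e := H.overFinIso (n := Fintype.card V) rfl
  let f' : Copy A (H.overFin rfl) := e.toCopy.comp f
  exact ⟨_, H.overFin rfl, f'.toSubgraph, e.connected_iff.1 hH, f'.isoToSubgraph.connected_iff.1 hA,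
    (gonality_congr f'.isoToSubgraph).symm, (gonality_congr e).symm⟩

/-- For every positive integer `t₀` there exist connected graphs `G ⊆ H` with
`gon(G) = t₀` and `gon(H) = 3`. -/
theorem stmt_14 (t₀ : ℕ) (ht₀ : 1 ≤ t₀) :
    ∃ (n : ℕ) (H : SimpleGraph (Fin n)) (G : H.Subgraph),
      H.Connected ∧ G.coe.Connected ∧ gonality G.coe = t₀ ∧ gonality H = 3 := by
  set u : Fin (6 * t₀ + 11) := ⟨0, by omega⟩ with hu
  set v : Fin (6 * t₀ + 11) := ⟨3 * t₀ + 5, by omega⟩ with hv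
  have huv : u ≠ v := by simp only [hu, hv, ne_eq, Fin.mk.injEq]; omega
  have hne : ∀ x : Fin (6 * t₀ + 11), x ≠ u → x.val ≠ 0 := fun x hx h => hx (Fin.ext h)
  have hH3 : ∀ k, (2 + 1) * (2 * 2 + 3) ≤ k + 1 →
      gonality (chain (k + 1) (chordedCycle t₀) u v) = 3 := fun k hk => by
    refine le_antisymm (gonality_chain_le (f := fun x => chordedPotential t₀ x.val) huv (by omega)
      ?_ ?_ (fun x hx hx' => ?_) (fun x hx => chordedPotential_descent t₀ x (hne x hx)) k)
      (lt_gonality_chain huv (chordedCycle_flow_eq_zero t₀ rfl rfl) hk)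
    · rw [lap_chordedPotential, if_pos rfl]; rfl
    · rw [lap_chordedPotential, if_neg (by simp only [hv]; omega), if_pos rfl]; rfl
    · rw [lap_chordedPotential, if_neg (hne x hx), if_neg fun h => hx' (Fin.ext h)]
  have hHconn : ∀ k, (chain (k + 1) (chordedCycle t₀) u v).Connected := fun k =>
    chain_connected fun x hx => chordedPotential_descent t₀ x (hne x hx)
  have hdist : ∀ x, x ≠ u → ∃ y, (cycle (6 * t₀ + 11)).Adj x y ∧
      min (y.val : ℤ) ((6 * t₀ + 11 : ℕ) - y.val) < min (x.val : ℤ) ((6 * t₀ + 11 : ℕ) - x.val) :=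
    fun x hx => cycle_distance_descent x (hne x hx)
  have hlapu := lap_cycle_distance (m := 6 * t₀ + 11) (by omega) u
  rw [if_pos rfl] at hlapu
  have hlap0 : ∀ x, x ≠ u → 0 ≤ lap (cycle (6 * t₀ + 11))
      (fun y => min (y.val : ℤ) ((6 * t₀ + 11 : ℕ) - y.val)) x := fun x hx => by
    have := lap_cycle_distance (m := 6 * t₀ + 11) (by omega) x
    rwa [if_neg (hne x hx)] at this
  obtain rfl | ht : t₀ = 1 ∨ 2 ≤ t₀ := by omega
  · have hc : (⊥ : SimpleGraph Unit).Connected :=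
      connected_of_descent (fun _ => 0) () fun w hw => (hw rfl).elim
    obtain ⟨n, H, G, h1, h2, h3, h4⟩ := exists_fin_subgraph (hHconn 20) hc
      ⟨⟨fun _ => (0, u), fun h => h.elim⟩, fun _ _ _ => rfl⟩
    exact ⟨n, H, G, h1, h2, h3.trans (gonality_of_subsingleton () _), h4.trans (hH3 20 (by omega))⟩
  · have hflow : ∀ S : Fin (6 * t₀ + 11) → ℤ,
        (∀ x, x ≠ u → x ≠ v → lap (cycle (6 * t₀ + 11)) S x = 0) →
        |lap (cycle (6 * t₀ + 11)) S u| ≤ t₀ → lap (cycle (6 * t₀ + 11)) S u = 0 := by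
      have hm : 6 * t₀ + 11 = 2 * (3 * t₀ + 5) + 1 := by omega
      clear_value u v
      have hu' : u.val = 0 := by rw [hu]
      have hv' : v.val = 3 * t₀ + 5 := by rw [hv]
      clear hu hv hne hH3 hHconn hdist hlapu hlap0
      generalize 6 * t₀ + 11 = m at *
      subst hm
      exact cycle_flow_eq_zero (by omega) hu' hv' (by omega)
    have hex : ∃ k, t₀ ≤ gonality (chain (k + 1) (cycle (6 * t₀ + 11)) u v) :=
      ⟨(t₀ + 1) * (2 * t₀ + 3), (lt_gonality_chain huv hflow (by omega)).le⟩
    have hk := Nat.find_spec hex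
    have hmin := fun j => Nat.find_min hex (m := j)
    generalize Nat.find hex = k at hk hmin
    have heq : gonality (chain (k + 1) (cycle (6 * t₀ + 11)) u v) = t₀ := by
      refine le_antisymm ?_ hk
      cases k with
      | zero => exact (gonality_chain_one_le hlapu hlap0 hdist).trans ht
      | succ k =>
        have h1 := hmin k (by omega)
        have h2 := gonality_chain_succ_le (v := v) (by simp [hu]; positivity) hlapu hlap0 hdist k
        exact h2.trans (by omega)
    obtain ⟨n, H, G, h1, h2, h3, h4⟩ := exists_fin_subgraph (hHconn (k + 20))
      (chain_connected hdist) (chainCopy (show cycle (6 * t₀ + 11) ≤ chordedCycle t₀ from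
        le_sup_left) u v (show k + 1 ≤ k + 20 + 1 by omega))
    exact ⟨n, H, G, h1, h2, h3.trans heq, h4.trans (hH3 _ (by omega))⟩
end
end
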